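/- arXiv:1609.01115 — 2 statements merged into one kernel-verified Lean document; each statement's English description precedes it below -/
import Mathlib

section
/- Let G be a strictly balanced graph with at least one edge and with a(G) automorphisms, and let p = n^{−1/ρ(G)}. Then the number N_G of copies of G in G(n,p) converges in distribution, as n → ∞, to a Poisson random variable with mean 1/a(G). -/
open Filter Topology FirstOrder

namespace RandomGraphSpectra

/-- The quantifier depth of a first-order (bounded) formula. -/
def qDepth {L : FirstOrder.Language} {α : Type*} :
    ∀ {n : ℕ}, L.BoundedFormula α n → ℕ
  | _, .falsum => 0
  | _, .equal _ _ => 0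
  | _, .rel _ _ => 0
  | _, .imp f g => max (qDepth f) (qDepth g)
  | _, .all f => qDepth f + 1

/-- A simple graph satisfies a first-order sentence in the language of graphs. -/
def GraphSat {V : Type*} (G : SimpleGraph V) (φ : FirstOrder.Language.graph.Sentence) : Prop :=
  @FirstOrder.Language.Sentence.Realize FirstOrder.Language.graph V G.structure φ

/-- The number of edges of a simple graph. -/
noncomputable def edgeCount {V : Type*} (G : SimpleGraph V) : ℕ := Nat.card G.edgeSet

/-- The probability that `G(n,p)` equals a fixed graph `G` on `{1,…,n}`. -/
noncomputable def weight (n : ℕ) (p : ℝ) (G : SimpleGraph (Fin n)) : ℝ :=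
  p ^ edgeCount G * (1 - p) ^ (n.choose 2 - edgeCount G)

open Classical in
/-- The probability that the Erdős–Rényi random graph `G(n,p)` satisfies a predicate `P`. -/
noncomputable def probPred (n : ℕ) (p : ℝ) (P : SimpleGraph (Fin n) → Prop) : ℝ :=
  ∑ᶠ G : SimpleGraph (Fin n), if P G then weight n p G else 0

/-- The probability that `G(n,p)` satisfies a first-order sentence. -/
noncomputable def probSat (n : ℕ) (p : ℝ) (φ : FirstOrder.Language.graph.Sentence) : ℝ :=
  probPred n p (fun G => GraphSat G φ)

open Classical in
/-- The probability that the pair of independent random graphs `G(n,p), G(m,q)`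
satisfies a predicate `P`. -/
noncomputable def probPred2 (n m : ℕ) (p q : ℝ)
    (P : SimpleGraph (Fin n) → SimpleGraph (Fin m) → Prop) : ℝ :=
  ∑ᶠ G : SimpleGraph (Fin n), ∑ᶠ H : SimpleGraph (Fin m),
    if P G H then weight n p G * weight m q H else 0

/-- The spectrum `S_k^1`: the set of `α ∈ (0,1)` such that for some first-order sentence `φ`
of quantifier depth at most `k`, with `p(n) = n^{-α}`, the probability that `G(n,p(n)) ⊨ φ`
does not tend to `0` and does not tend to `1`. -/
def S1 (k : ℕ) : Set ℝ :=
  {α | α ∈ Set.Ioo (0 : ℝ) 1 ∧ ∃ φ : FirstOrder.Language.graph.Sentence, qDepth φ ≤ k ∧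
    ¬(Tendsto (fun n : ℕ => probSat n ((n : ℝ) ^ (-α)) φ) atTop (nhds 0) ∨
      Tendsto (fun n : ℕ => probSat n ((n : ℝ) ^ (-α)) φ) atTop (nhds 1))}

/-- The spectrum `S_k^2`. -/
def S2 (k : ℕ) : Set ℝ :=
  {α | α ∈ Set.Ioo (0 : ℝ) 1 ∧ ∃ φ : FirstOrder.Language.graph.Sentence, qDepth φ ≤ k ∧
    ¬∃ δ : ℝ, (δ = 0 ∨ δ = 1) ∧ ∃ ε : ℝ, 0 < ε ∧ ∀ p : ℕ → ℝ,
      (∀ n : ℕ, 1 ≤ n → (n : ℝ) ^ (-α - ε) < p n ∧ p n < (n : ℝ) ^ (-α + ε)) →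
      Tendsto (fun n : ℕ => probSat n (p n) φ) atTop (nhds δ)}

/-- `G(n, p(n))` obeys the zero-one `k`-law. -/
def ZeroOneKLaw (k : ℕ) (p : ℕ → ℝ) : Prop :=
  ∀ φ : FirstOrder.Language.graph.Sentence, qDepth φ ≤ k →
    Tendsto (fun n : ℕ => probSat n (p n) φ) atTop (nhds 0) ∨
    Tendsto (fun n : ℕ => probSat n (p n) φ) atTop (nhds 1)

/-- The density `ρ(G) = e(G)/v(G)` of a graph. -/
noncomputable def density {V : Type*} (G : SimpleGraph V) : ℝ :=
  (Nat.card G.edgeSet : ℝ) / (Nat.card V : ℝ)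

/-- A graph is strictly balanced if every proper subgraph with at least one vertex has
strictly smaller density. -/
def StrictlyBalanced {V : Type*} (G : SimpleGraph V) : Prop :=
  ∀ H : G.Subgraph, H ≠ ⊤ → H.verts.Nonempty → density H.coe < density G

/-- `ρ^max(G)`: the maximum density of a subgraph of `G` with at least one vertex. -/
noncomputable def maxDensity {V : Type*} (G : SimpleGraph V) : ℝ :=
  sSup {x : ℝ | ∃ H : G.Subgraph, H.verts.Nonempty ∧ x = density H.coe}

/-- The relative density `ρ(K,H) = e(K,H)/v(K,H)` of a pair of nested subgraphs. -/
noncomputable def pairDensity {V : Type*} {G : SimpleGraph V} (K H : G.Subgraph) : ℝ :=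
  ((Nat.card K.edgeSet : ℝ) - (Nat.card H.edgeSet : ℝ)) /
    ((Nat.card K.verts : ℝ) - (Nat.card H.verts : ℝ))

/-- `ρ^max(G,H)` where the ambient graph `G` corresponds to the top subgraph. -/
noncomputable def maxPairDensity {V : Type*} {G : SimpleGraph V} (H : G.Subgraph) : ℝ :=
  sSup {x : ℝ | ∃ K : G.Subgraph, H < K ∧ x = pairDensity K H}

/-- `f_α(K,H) = v(K,H) - α·e(K,H)`. -/
noncomputable def fAlpha (α : ℝ) {V : Type*} {G : SimpleGraph V} (K H : G.Subgraph) : ℝ :=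
  ((Nat.card K.verts : ℝ) - (Nat.card H.verts : ℝ)) -
    α * ((Nat.card K.edgeSet : ℝ) - (Nat.card H.edgeSet : ℝ))

/-- The pair `(G,H)` is `α`-safe: `f_α(S,H) > 0` for every `S` with `H ⊂ S ⊆ G`. -/
def AlphaSafe (α : ℝ) {V : Type*} (G : SimpleGraph V) (H : G.Subgraph) : Prop :=
  ∀ S : G.Subgraph, H < S → 0 < fAlpha α S H

/-- The pair `(G,H)` is strictly balanced: `ρ(G,H) > ρ(K,H)` for every `H ⊂ K ⊂ G`. -/
def StrictlyBalancedPair {V : Type*} (G : SimpleGraph V) (H : G.Subgraph) : Prop :=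
  ∀ K : G.Subgraph, H < K → K ≠ ⊤ → pairDensity K H < pairDensity (⊤ : G.Subgraph) H

/-- The set `E(K) \ (E(H) ∪ E(K∖H))` is non-empty: `K` has an edge, not an edge of `H`,
with at least one endpoint in `V(H)`. -/
def TouchesRoots {V : Type*} {G : SimpleGraph V} (H K : G.Subgraph) : Prop :=
  ∃ u v : V, K.Adj u v ∧ ¬H.Adj u v ∧ (u ∈ H.verts ∨ v ∈ H.verts)

/-- `e^min(G,H)` (`G` being the top subgraph). -/
noncomputable def eMin {V : Type*} {G : SimpleGraph V} (H : G.Subgraph) : ℕ :=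
  sInf {e : ℕ | ∃ K : G.Subgraph, H < K ∧ TouchesRoots H K ∧
    pairDensity K H = maxPairDensity H ∧ e = Nat.card K.edgeSet - Nat.card H.edgeSet}

/-- `f` realizes a `(G,(r 0,…,r (m-1)))`-extension of the tuple `x` in `Γ`: an injective copy
of the vertex set of `G` sending the roots to `x` and containing all edges of `E(G)∖E(H)`
as edges outside the root-induced subgraph. -/
def IsExtension {W V : Type*} (Gp : SimpleGraph W) (H : Gp.Subgraph) {m : ℕ}
    (r : Fin m → W) (Γ : SimpleGraph V) (x : Fin m → V) (f : W → V) : Prop :=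
  Function.Injective f ∧ (∀ j : Fin m, f (r j) = x j) ∧
    ∀ u v : W, Gp.Adj u v → ¬H.Adj u v →
      Γ.Adj (f u) (f v) ∧ ¬(u ∈ H.verts ∧ v ∈ H.verts)

/-- Strict extension: the implication above is an equivalence. -/
def IsStrictExtension {W V : Type*} (Gp : SimpleGraph W) (H : Gp.Subgraph) {m : ℕ}
    (r : Fin m → W) (Γ : SimpleGraph V) (x : Fin m → V) (f : W → V) : Prop :=
  Function.Injective f ∧ (∀ j : Fin m, f (r j) = x j) ∧
    ∀ u v : W, (Gp.Adj u v ∧ ¬H.Adj u v) ↔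
      (Γ.Adj (f u) (f v) ∧ ¬(u ∈ H.verts ∧ v ∈ H.verts))

/-- The pair of subgraphs of `Γ` with vertex sets `B ⊆ A` is `(K,T)`-maximal in `Γ`
(where `T ⊂ K` has roots enumerated by `s`). -/
def PairMaximal {U V : Type*} (Kp : SimpleGraph U) (T : Kp.Subgraph) {t : ℕ}
    (s : Fin t → U) (Γ : SimpleGraph V) (A B : Set V) : Prop :=
  ∀ tup : Fin t → V, Function.Injective tup → (∀ i, tup i ∈ A) → (∃ i, tup i ∉ B) →
    ¬∃ f : U → V, IsStrictExtension Kp T s Γ tup f ∧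
      (∀ u : U, f u ∈ A → f u ∈ Set.range tup) ∧
      (∀ u : U, f u ∉ Set.range tup → ∀ a ∈ A, a ∉ Set.range tup → ¬Γ.Adj (f u) a)

/-- The subgraph of `Γ` with vertex set `A` is `(K,T)`-maximal in `Γ`. -/
def GraphMaximal {U V : Type*} (Kp : SimpleGraph U) (T : Kp.Subgraph) {t : ℕ}
    (s : Fin t → U) (Γ : SimpleGraph V) (A : Set V) : Prop :=
  ∀ tup : Fin t → V, Function.Injective tup → (∀ i, tup i ∈ A) →
    ¬∃ f : U → V, IsStrictExtension Kp T s Γ tup f ∧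
      (∀ u : U, f u ∈ A → f u ∈ Set.range tup) ∧
      (∀ u : U, f u ∉ Set.range tup → ∀ a ∈ A, a ∉ Set.range tup → ¬Γ.Adj (f u) a)

/-- `Γ` contains a copy of `Gp`. -/
def ContainsCopy {W V : Type*} (Gp : SimpleGraph W) (Γ : SimpleGraph V) : Prop :=
  ∃ f : W → V, Function.Injective f ∧ ∀ u v : W, Gp.Adj u v → Γ.Adj (f u) (f v)

/-- The number of copies of `Gp` in `Γ`: subgraphs of `Γ` isomorphic to `Gp`. -/
noncomputable def numCopies {W V : Type*} (Gp : SimpleGraph W) (Γ : SimpleGraph V) : ℕ :=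
  Nat.card {H : Γ.Subgraph // Nonempty (Gp ≃g H.coe)}

/-- The matched tuples of chosen vertices induce a partial isomorphism. -/
def PartialIso {V W : Type*} (G : SimpleGraph V) (H : SimpleGraph W)
    (xs : List V) (ys : List W) : Prop :=
  ∃ h : xs.length = ys.length,
    ∀ j k : Fin xs.length,
      (xs.get j = xs.get k ↔ ys.get (Fin.cast h j) = ys.get (Fin.cast h k)) ∧
      (G.Adj (xs.get j) (xs.get k) ↔ H.Adj (ys.get (Fin.cast h j)) (ys.get (Fin.cast h k)))

/-- Duplicator has a winning strategy in the remaining `i` rounds of the Ehrenfeucht game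
on `(G,H)` from the position given by the already chosen vertices `xs`, `ys`. -/
def DuplicatorWinsFrom {V W : Type*} (G : SimpleGraph V) (H : SimpleGraph W) :
    ℕ → List V → List W → Prop
  | 0, xs, ys => PartialIso G H xs ys
  | (i + 1), xs, ys =>
      (∀ x : V, ∃ y : W, DuplicatorWinsFrom G H i (x :: xs) (y :: ys)) ∧
      (∀ y : W, ∃ x : V, DuplicatorWinsFrom G H i (x :: xs) (y :: ys))

/-- Duplicator has a winning strategy in the Ehrenfeucht game `EHR(G,H,i)`. -/
def DuplicatorWins {V W : Type*} (G : SimpleGraph V) (H : SimpleGraph W) (i : ℕ) : Prop :=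
  DuplicatorWinsFrom G H i [] []

end RandomGraphSpectra

namespace RandomGraphSpectra

/-- The class `𝒮` of graphs from Section "Properties which imply the existence of
Duplicator's winning strategy" (properties 1)–3)). -/
def GoodGraph (k b : ℕ) (α : ℝ) {V : Type*} (Γ : SimpleGraph V) : Prop :=
  -- 1) no strictly balanced subgraph with at most `2^{2k}·b` vertices and density `> 1/α`
  (∀ A : Γ.Subgraph, Nat.card A.verts ≤ 2 ^ (2 * k) * b → StrictlyBalanced A.coe →
      density A.coe ≤ 1 / α) ∧
  -- 2) strict extensions of α-safe pairs which are `(K₁,K₂)`-maximal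
  (∀ (l h : ℕ) (H₁ : SimpleGraph (Fin l)) (H₂ : H₁.Subgraph) (r : Fin h → Fin l),
      Function.Injective r → Set.range r = H₂.verts →
      l ≤ 2 ^ (2 * k) * b + k * 2 ^ k → AlphaSafe α H₁ H₂ →
      ∀ x : Fin h → V, Function.Injective x →
        ∃ f : Fin l → V, IsStrictExtension H₁ H₂ r Γ x f ∧
          ∀ (u t : ℕ) (K₁ : SimpleGraph (Fin u)) (K₂ : K₁.Subgraph) (s : Fin t → Fin u),
            Function.Injective s → Set.range s = K₂.verts →
            u ≤ 2 ^ k → Nat.card K₂.verts ≤ 2 → fAlpha α (⊤ : K₁.Subgraph) K₂ < 0 →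
            PairMaximal K₁ K₂ s Γ (Set.range f) (Set.range x)) ∧
  -- 3) maximal copies of sparse strictly balanced graphs
  (∀ (w : ℕ) (Hp : SimpleGraph (Fin w)), w ≤ 2 ^ (2 * k) * b → StrictlyBalanced Hp →
      density Hp < 1 / α →
      ∃ f : Fin w → V, Function.Injective f ∧
        (∀ u v : Fin w, Hp.Adj u v → Γ.Adj (f u) (f v)) ∧
        ∀ (u t : ℕ) (K₁ : SimpleGraph (Fin u)) (K₂ : K₁.Subgraph) (s : Fin t → Fin u),
          Function.Injective s → Set.range s = K₂.verts →
          u ≤ 2 ^ k → Nat.card K₂.verts ≤ 2 → fAlpha α (⊤ : K₁.Subgraph) K₂ < 0 →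
          GraphMaximal K₁ K₂ s Γ (Set.range f))

end RandomGraphSpectra

namespace RandomGraphSpectra

open Filter Topology

section Abstract
set_option linter.unusedSectionVars false
variable {X : Type*} [DecidableEq X]

/-- Expectation of `φ` over a `p`-random subset of `U`. -/
noncomputable def Ex (U : Finset X) (p : ℝ) (φ : Finset X → ℝ) : ℝ :=
  ∑ S ∈ U.powerset, p ^ S.card * (1 - p) ^ (U.card - S.card) * φ S

lemma Ex_one (U : Finset X) (p : ℝ) : Ex U p (fun _ => 1) = 1 := by
  have := Finset.sum_pow_mul_eq_add_pow p (1 - p) U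
  simp [Ex, this]

lemma Ex_indep (U A : Finset X) (hA : A ⊆ U) (p : ℝ) (F G : Finset X → ℝ) :
    Ex U p (fun S => F (S ∩ A) * G (S \ A)) = Ex A p F * Ex (U \ A) p G := by
  unfold Ex
  rw [Finset.sum_mul_sum, ← Finset.sum_product']
  refine Finset.sum_nbij' (fun S => (S ∩ A, S \ A)) (fun q => q.1 ∪ q.2) ?_ ?_ ?_ ?_ ?_
  · intro S hS
    simp only [Finset.mem_powerset, Finset.mem_product] at *
    exact ⟨Finset.inter_subset_right, Finset.sdiff_subset_sdiff hS le_rfl⟩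
  · rintro ⟨T, V⟩ h
    simp only [Finset.mem_powerset, Finset.mem_product] at *
    exact Finset.union_subset (h.1.trans hA) (h.2.trans Finset.sdiff_subset)
  · intro S hS
    ext x; simp; tauto
  · rintro ⟨T, V⟩ h
    simp only [Finset.mem_powerset, Finset.mem_product] at *
    obtain ⟨h1, h2⟩ := h
    refine Prod.ext ?_ ?_
    · ext x
      have := @h1 x
      have := @h2 x
      simp at *; tauto
    · ext x
      have := @h1 x
      have := @h2 x
      simp at *; tauto
  · intro S hS
    simp only [Finset.mem_powerset] at hS
    have h1 : (S ∩ A).card + (S \ A).card = S.card := Finset.card_inter_add_card_sdiff S A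
    have h2 : (U \ A).card + A.card = U.card := Finset.card_sdiff_add_card_eq_card hA
    have h3 : (S ∩ A).card ≤ A.card := Finset.card_le_card Finset.inter_subset_right
    have h4 : (S \ A).card ≤ (U \ A).card :=
      Finset.card_le_card (Finset.sdiff_subset_sdiff hS le_rfl)
    have h5 : U.card - S.card = (A.card - (S ∩ A).card) + ((U \ A).card - (S \ A).card) := by omega
    rw [h5, ← h1, pow_add, pow_add]
    ring

lemma Ex_indep' (U A : Finset X) (hA : A ⊆ U) (p : ℝ) (G : Finset X → ℝ) :
    Ex U p (fun S => if A ⊆ S then G (S \ A) else 0) = p ^ A.card * Ex U p (fun S => G (S \ A)) := by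
  have h1 := Ex_indep U A hA p (fun T => if A ⊆ T then 1 else 0) G
  have h2 := Ex_indep U A hA p (fun _ => 1) G
  have e1 : (fun S => if A ⊆ S then G (S \ A) else 0) =
      (fun S => (if A ⊆ S ∩ A then (1:ℝ) else 0) * G (S \ A)) := by
    funext S
    have : A ⊆ S ∩ A ↔ A ⊆ S := by simp [Finset.subset_inter_iff]
    simp [this]
  have e2 : Ex A p (fun T => if A ⊆ T then (1:ℝ) else 0) = p ^ A.card := by
    unfold Ex
    rw [Finset.sum_eq_single A]
    · simp
    · intro T hT hne
      have : ¬ A ⊆ T := fun h => hne (Finset.Subset.antisymm (Finset.mem_powerset.1 hT) h)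
      simp [this]
    · simp
  rw [e1, h1, e2]
  simp only [one_mul, Ex_one] at h2
  rw [h2]

lemma Ex_subset (U A : Finset X) (hA : A ⊆ U) (p : ℝ) :
    Ex U p (fun S => if A ⊆ S then 1 else 0) = p ^ A.card := by
  have := Ex_indep' U A hA p (fun _ => 1)
  rwa [Ex_one, mul_one] at this

lemma Ex_mono (U : Finset X) {p : ℝ} (h0 : 0 ≤ p) (h1 : p ≤ 1) {φ ψ : Finset X → ℝ}
    (h : ∀ S, φ S ≤ ψ S) : Ex U p φ ≤ Ex U p ψ := by
  unfold Ex
  have : 0 ≤ 1 - p := by linarith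
  gcongr with S
  exact h S

lemma Ex_sum {ι : Type*} (s : Finset ι) (U : Finset X) (p : ℝ) (φ : ι → Finset X → ℝ) :
    Ex U p (fun S => ∑ i ∈ s, φ i S) = ∑ i ∈ s, Ex U p (φ i) := by
  unfold Ex
  simp only [Finset.mul_sum]
  rw [Finset.sum_comm]

lemma Ex_sub (U : Finset X) (p : ℝ) (φ ψ : Finset X → ℝ) :
    Ex U p (fun S => φ S - ψ S) = Ex U p φ - Ex U p ψ := by
  unfold Ex
  simp only [mul_sub, Finset.sum_sub_distrib]

lemma Ex_const_mul (U : Finset X) (p c : ℝ) (φ : Finset X → ℝ) :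
    Ex U p (fun S => c * φ S) = c * Ex U p φ := by
  unfold Ex
  rw [Finset.mul_sum]
  refine Finset.sum_congr rfl fun S _ => by ring

lemma Ex_abs_sub_le (U : Finset X) {p : ℝ} (h0 : 0 ≤ p) (h1 : p ≤ 1) {φ ψ χ : Finset X → ℝ}
    (h : ∀ S, |φ S - ψ S| ≤ χ S) : |Ex U p φ - Ex U p ψ| ≤ Ex U p χ := by
  rw [← Ex_sub, abs_le]
  constructor
  · have : -Ex U p χ = Ex U p (fun S => (-1) * χ S) := by rw [Ex_const_mul]; ring
    rw [this]
    exact Ex_mono U h0 h1 fun S => by have := (abs_le.1 (h S)).1; linarith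
  · exact Ex_mono U h0 h1 fun S => (abs_le.1 (h S)).2

/-- Number of members of the family contained in `S`. -/
def cnt (C : Finset (Finset X)) (S : Finset X) : ℕ := (C.filter (fun A => A ⊆ S)).card

/-- Probability that exactly `j` members of the family are contained in the random set. -/
noncomputable def Pj (C : Finset (Finset X)) (U : Finset X) (p : ℝ) (j : ℕ) : ℝ :=
  Ex U p (fun S => if cnt C S = j then 1 else 0)

lemma ind_diff (a b : ℕ) (j : ℕ) (s : ℝ) (hs : 0 ≤ s) (h : a ≠ b → 1 ≤ s) :
    |(if a = j then (1:ℝ) else 0) - (if b = j then 1 else 0)| ≤ s := by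
  by_cases hab : a = b
  · subst hab; simpa using hs
  · have := h hab
    split_ifs <;> simp <;> linarith

lemma cnt_split (C : Finset (Finset X)) (A S : Finset X) :
    cnt C S = cnt (C.filter (fun B => Disjoint B A)) S +
      ((C.filter (fun B => ¬ Disjoint B A)).filter (fun B => B ⊆ S)).card := by
  unfold cnt
  rw [Finset.filter_comm (fun B => Disjoint B A), Finset.filter_comm (fun B => ¬ Disjoint B A)]
  exact (Finset.card_filter_add_card_filter_not _).symm

lemma sum_ind (D : Finset (Finset X)) (S : Finset X) :
    ∑ B ∈ D, (if B ⊆ S then (1:ℝ) else 0) = ((D.filter (fun B => B ⊆ S)).card : ℝ) := by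
  simp [Finset.sum_boole]

theorem recursion (C : Finset (Finset X)) (U : Finset X) {p : ℝ} (h0 : 0 ≤ p) (h1 : p ≤ 1)
    (hU : ∀ A ∈ C, A ⊆ U) (hne : ∀ A ∈ C, A.Nonempty) (j : ℕ) :
    |((j + 1 : ℕ) : ℝ) * Pj C U p (j + 1) - (∑ A ∈ C, p ^ A.card) * Pj C U p j| ≤
      (∑ A ∈ C, ∑ B ∈ C.filter (fun B => ¬ Disjoint B A ∧ B ≠ A), p ^ (A ∪ B).card) +
      ∑ A ∈ C, ∑ B ∈ C.filter (fun B => ¬ Disjoint B A), p ^ A.card * p ^ B.card := by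
  -- size biasing
  have e1 : ((j + 1 : ℕ) : ℝ) * Pj C U p (j + 1) =
      ∑ A ∈ C, Ex U p (fun S => if A ⊆ S then (if cnt C S = j + 1 then 1 else 0) else 0) := by
    rw [← Ex_sum, Pj, ← Ex_const_mul]
    congr 1
    funext S
    by_cases h : cnt C S = j + 1
    · simp only [h, if_true]
      rw [sum_ind]
      rw [cnt] at h
      rw [h]; simp
    · simp [h]
  rw [e1, Finset.sum_mul, ← Finset.sum_sub_distrib, ← Finset.sum_add_distrib]
  refine (Finset.abs_sum_le_sum_abs _ _).trans (Finset.sum_le_sum fun A hA => ?_)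
  set D := C.filter (fun B => Disjoint B A) with hD
  -- independence
  have hdep : ∀ S, cnt D (S \ A) = cnt D S := by
    intro S
    unfold cnt
    congr 1
    refine Finset.filter_congr fun B hB => ?_
    have : Disjoint B A := (Finset.mem_filter.1 hB).2
    rw [Finset.subset_sdiff]; tauto
  have e2 : Ex U p (fun S => if A ⊆ S then (if cnt D S = j then (1:ℝ) else 0) else 0) =
      p ^ A.card * Pj D U p j := by
    have := Ex_indep' U A (hU A hA) p (fun S => if cnt D S = j then (1:ℝ) else 0)
    simp only [hdep] at this
    exact this
  have b1 : |Ex U p (fun S => if A ⊆ S then (if cnt C S = j + 1 then (1:ℝ) else 0) else 0) -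
      p ^ A.card * Pj D U p j| ≤
      ∑ B ∈ C.filter (fun B => ¬ Disjoint B A ∧ B ≠ A), p ^ (A ∪ B).card := by
    rw [← e2]
    have e3 : ∑ B ∈ C.filter (fun B => ¬ Disjoint B A ∧ B ≠ A), p ^ (A ∪ B).card =
        Ex U p (fun S => ∑ B ∈ C.filter (fun B => ¬ Disjoint B A ∧ B ≠ A),
          if A ∪ B ⊆ S then (1:ℝ) else 0) := by
      rw [Ex_sum]
      refine Finset.sum_congr rfl fun B hB => ?_
      rw [Ex_subset]
      exact Finset.union_subset (hU A hA) (hU B (Finset.mem_filter.1 hB).1)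
    rw [e3]
    refine Ex_abs_sub_le U h0 h1 fun S => ?_
    by_cases hS : A ⊆ S
    · simp only [hS, if_true]
      have e4 : (∑ B ∈ C.filter (fun B => ¬ Disjoint B A ∧ B ≠ A),
          if A ∪ B ⊆ S then (1:ℝ) else 0) =
          (((C.filter (fun B => ¬ Disjoint B A ∧ B ≠ A)).filter (fun B => B ⊆ S)).card : ℝ) := by
        rw [← sum_ind]
        refine Finset.sum_congr rfl fun B _ => ?_
        simp [Finset.union_subset_iff, hS]
      rw [e4]
      have e5 : cnt C S = cnt D S + 1 +
          ((C.filter (fun B => ¬ Disjoint B A ∧ B ≠ A)).filter (fun B => B ⊆ S)).card := by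
        rw [cnt_split C A S, add_assoc]
        congr 1
        have : (C.filter (fun B => ¬ Disjoint B A)).filter (fun B => B ⊆ S) =
            insert A ((C.filter (fun B => ¬ Disjoint B A ∧ B ≠ A)).filter (fun B => B ⊆ S)) := by
          ext B
          simp only [Finset.mem_filter, Finset.mem_insert]
          constructor
          · rintro ⟨⟨a, b⟩, c⟩
            by_cases hBA : B = A
            · exact Or.inl hBA
            · exact Or.inr ⟨⟨a, b, hBA⟩, c⟩
          · rintro (rfl | ⟨⟨a, b, _⟩, c⟩)
            · refine ⟨⟨hA, ?_⟩, hS⟩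
              rw [disjoint_self]
              exact (hne B hA).ne_empty
            · exact ⟨⟨a, b⟩, c⟩
        rw [this, Finset.card_insert_of_notMem (by simp), add_comm]
      have := ind_diff (cnt C S) (cnt D S + 1) (j + 1)
        (((C.filter (fun B => ¬ Disjoint B A ∧ B ≠ A)).filter (fun B => B ⊆ S)).card : ℝ)
        (by positivity) (by
          intro h
          have : 1 ≤ ((C.filter (fun B => ¬ Disjoint B A ∧ B ≠ A)).filter (fun B => B ⊆ S)).card := by
            omega
          exact_mod_cast this)
      simpa using this
    · simp only [hS, if_false, sub_zero, abs_zero]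
      exact Finset.sum_nonneg fun B _ => by split_ifs <;> norm_num
  have b2 : |Pj D U p j - Pj C U p j| ≤ ∑ B ∈ C.filter (fun B => ¬ Disjoint B A), p ^ B.card := by
    have e3 : ∑ B ∈ C.filter (fun B => ¬ Disjoint B A), p ^ B.card =
        Ex U p (fun S => ∑ B ∈ C.filter (fun B => ¬ Disjoint B A),
          if B ⊆ S then (1:ℝ) else 0) := by
      rw [Ex_sum]
      refine Finset.sum_congr rfl fun B hB => ?_
      rw [Ex_subset _ _ (hU B (Finset.mem_filter.1 hB).1)]
    rw [e3]
    refine Ex_abs_sub_le U h0 h1 fun S => ?_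
    rw [sum_ind]
    refine ind_diff _ _ _ _ (by positivity) ?_
    intro h
    have := cnt_split C A S
    have : 1 ≤ ((C.filter (fun B => ¬ Disjoint B A)).filter (fun B => B ⊆ S)).card := by
      rw [← hD] at this
      omega
    exact_mod_cast this
  have b3 : |p ^ A.card * Pj D U p j - p ^ A.card * Pj C U p j| ≤
      ∑ B ∈ C.filter (fun B => ¬ Disjoint B A), p ^ A.card * p ^ B.card := by
    rw [← mul_sub, abs_mul, abs_of_nonneg (by positivity : (0:ℝ) ≤ p ^ A.card), ← Finset.mul_sum]
    gcongr
  exact (abs_sub_le _ _ _).trans (add_le_add b1 b3)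

lemma Pj_nonneg (C : Finset (Finset X)) (U : Finset X) {p : ℝ} (h0 : 0 ≤ p) (h1 : p ≤ 1) (j : ℕ) :
    0 ≤ Pj C U p j := by
  have := Ex_mono U h0 h1 (φ := fun _ => 0 * 1) (ψ := fun S => if cnt C S = j then (1:ℝ) else 0)
    (fun S => by split_ifs <;> norm_num)
  rw [Ex_const_mul, zero_mul] at this
  exact this

lemma Pj_sum_le (C : Finset (Finset X)) (U : Finset X) {p : ℝ} (h0 : 0 ≤ p) (h1 : p ≤ 1) (M : ℕ) :
    ∑ j ∈ Finset.range M, Pj C U p j ≤ 1 := by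
  unfold Pj
  rw [← Ex_sum]
  refine le_trans (Ex_mono U h0 h1 (ψ := fun _ => 1) fun S => ?_) (Ex_one U p).le
  rw [Finset.sum_ite_eq]
  split_ifs <;> norm_num

lemma Pj_sum_ge (C : Finset (Finset X)) (U : Finset X) {p : ℝ} (h0 : 0 ≤ p) (h1 : p ≤ 1)
    (hU : ∀ A ∈ C, A ⊆ U) (M : ℕ) (hM : 0 < M) :
    1 - (∑ A ∈ C, p ^ A.card) / M ≤ ∑ j ∈ Finset.range M, Pj C U p j := by
  unfold Pj
  have : ∑ A ∈ C, p ^ A.card = Ex U p (fun S => (cnt C S : ℝ)) := by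
    simp only [cnt, ← sum_ind]
    rw [Ex_sum]
    exact Finset.sum_congr rfl fun A hA => (Ex_subset _ _ (hU A hA) p).symm
  have h3 : 1 - (∑ A ∈ C, p ^ A.card) / M =
      Ex U p (fun S => (fun _ => (1:ℝ)) S - (M:ℝ)⁻¹ * (cnt C S : ℝ)) := by
    rw [Ex_sub, Ex_one, Ex_const_mul, this, div_eq_inv_mul]
  rw [← Ex_sum, h3]
  refine Ex_mono U h0 h1 fun S => ?_
  rw [Finset.sum_ite_eq]
  have hM' : (0:ℝ) < M := by exact_mod_cast hM
  split_ifs with h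
  · have : 0 ≤ (M:ℝ)⁻¹ * (cnt C S : ℝ) := by positivity
    linarith
  · have : (M:ℝ) ≤ cnt C S := by
      simp at h; exact_mod_cast h
    have : 1 ≤ (M:ℝ)⁻¹ * (cnt C S : ℝ) := by
      rw [← div_eq_inv_mul, le_div_iff₀ hM']; linarith
    linarith

end Abstract

theorem seq_limit (a : ℕ → ℕ → ℝ) (l d : ℕ → ℝ) (lam : ℝ) (hl : Tendsto l atTop (𝓝 lam))
    (hd : Tendsto d atTop (𝓝 0))
    (h0 : ∀ᶠ n in atTop, ∀ j, 0 ≤ a n j)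
    (hle : ∀ᶠ n in atTop, ∀ M, ∑ j ∈ Finset.range M, a n j ≤ 1)
    (hge : ∀ᶠ n in atTop, ∀ M : ℕ, 0 < M → 1 - l n / M ≤ ∑ j ∈ Finset.range M, a n j)
    (hrec : ∀ᶠ n in atTop, ∀ j : ℕ, |((j + 1 : ℕ) : ℝ) * a n (j + 1) - l n * a n j| ≤ d n) (j : ℕ) :
    Tendsto (fun n => a n j) atTop (𝓝 (Real.exp (-lam) * lam ^ j / (Nat.factorial j : ℝ))) := by
  have hbd : ∀ᶠ n in atTop, ∀ j, |a n j| ≤ 1 := by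
    filter_upwards [h0, hle] with n h0 hle j
    rw [abs_of_nonneg (h0 j)]
    have h1 := hle (j + 1)
    rw [Finset.sum_range_succ] at h1
    have h2 : 0 ≤ ∑ i ∈ Finset.range j, a n i := Finset.sum_nonneg fun i _ => h0 i
    linarith
  have hb : ∀ j, Tendsto (fun n => a n j - a n 0 * (lam ^ j / (Nat.factorial j : ℝ))) atTop (𝓝 0) := by
    intro j
    induction j with
    | zero => simp
    | succ j ih =>
      have t1 : Tendsto (fun n => ((j + 1 : ℕ) : ℝ) * a n (j + 1) - l n * a n j) atTop (𝓝 0) := by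
        refine squeeze_zero_norm' ?_ hd
        filter_upwards [hrec] with n hn
        simpa using hn j
      have t2 : Tendsto (fun n => (l n - lam) * a n j) atTop (𝓝 0) := by
        have : Tendsto (fun n => |l n - lam|) atTop (𝓝 0) := by
          have := (hl.sub_const lam).abs
          simpa using this
        refine squeeze_zero_norm' ?_ this
        filter_upwards [hbd] with n hn
        rw [Real.norm_eq_abs, abs_mul]
        exact mul_le_of_le_one_right (abs_nonneg _) (hn j)
      have t3 := ((t1.add t2).add (ih.const_mul lam)).const_mul (((j + 1 : ℕ) : ℝ)⁻¹)
      simp only [add_zero, mul_zero] at t3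
      refine t3.congr fun n => ?_
      have : ((j:ℝ) + 1) ≠ 0 := by positivity
      rw [Nat.factorial_succ]
      push_cast
      field_simp
      ring
  have hsM : Tendsto (fun M : ℕ => ∑ j ∈ Finset.range M, lam ^ j / (Nat.factorial j : ℝ)) atTop
      (𝓝 (Real.exp lam)) := by
    have := (NormedSpace.expSeries_div_hasSum_exp (𝔸 := ℝ) lam).tendsto_sum_nat
    rw [← Real.exp_eq_exp_ℝ] at this
    exact this
  have hmain : Tendsto (fun n => a n 0 * Real.exp lam) atTop (𝓝 1) := by
    rw [Metric.tendsto_atTop']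
    intro ε hε
    have hM1 : Tendsto (fun M : ℕ => |Real.exp lam - ∑ j ∈ Finset.range M, lam ^ j / (Nat.factorial j : ℝ)|
        + (|lam| + 1) / (M : ℝ)) atTop (𝓝 0) := by
      have a1 := (hsM.const_sub (Real.exp lam)).abs
      have a2 := tendsto_const_div_atTop_nhds_zero_nat (|lam| + 1)
      simpa using a1.add a2
    obtain ⟨M, hMa, hMb⟩ := ((hM1.eventually (gt_mem_nhds (half_pos hε))).and
      (eventually_gt_atTop 0)).exists
    have hs : Tendsto (fun n => ∑ j ∈ Finset.range M,
        (a n j - a n 0 * (lam ^ j / (Nat.factorial j : ℝ)))) atTop (𝓝 0) := by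
      have := tendsto_finsetSum (Finset.range M) fun j _ => hb j
      simpa using this
    have hs' := hs.abs
    rw [abs_zero] at hs'
    have hl' : ∀ᶠ n in atTop, l n < |lam| + 1 :=
      hl.eventually (gt_mem_nhds (by have := le_abs_self lam; linarith))
    obtain ⟨N, hN⟩ := eventually_atTop.1 ((hs'.eventually (gt_mem_nhds (half_pos hε))).and
      ((hbd.and (hle.and hge)).and hl'))
    refine ⟨N, fun n hn => ?_⟩
    obtain ⟨q1, ⟨q2, q3, q4⟩, q5⟩ := hN n hn.le
    rw [Finset.sum_sub_distrib, ← Finset.mul_sum] at q1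
    set s := ∑ j ∈ Finset.range M, lam ^ j / (Nat.factorial j : ℝ)
    set t := ∑ j ∈ Finset.range M, a n j
    have r3 : t ≤ 1 := q3 M
    have r4 : 1 - l n / M ≤ t := q4 M hMb
    have hM' : (0:ℝ) < M := by exact_mod_cast hMb
    have r5 : l n / M ≤ (|lam| + 1) / M := by gcongr
    have r6 : |a n 0 * (Real.exp lam - s)| ≤ |Real.exp lam - s| := by
      rw [abs_mul]; exact mul_le_of_le_one_left (abs_nonneg _) (q2 0)
    rw [Real.dist_eq]
    have r7 := abs_lt.1 q1
    have r8 := abs_le.1 r6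
    rw [abs_lt]
    constructor <;> nlinarith
  have ha0 : Tendsto (fun n => a n 0) atTop (𝓝 (Real.exp (-lam))) := by
    have := hmain.mul_const (Real.exp (-lam))
    rw [one_mul] at this
    refine this.congr fun n => ?_
    rw [mul_assoc, ← Real.exp_add]; simp
  have := (hb j).add (ha0.mul_const (lam ^ j / (Nat.factorial j : ℝ)))
  rw [zero_add] at this
  rw [mul_div_assoc]
  refine this.congr fun n => by ring

section Graphs
open scoped Classical

lemma exists_adj {W : Type*} [Fintype W] (Gp : SimpleGraph W)
    (hE : Gp.edgeSet.Nonempty) (hSB : StrictlyBalanced Gp) (w : W) : ∃ u, Gp.Adj w u := by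
  by_contra hw
  push Not at hw
  obtain ⟨e, he⟩ := hE
  induction e using Sym2.ind with
  | _ x y =>
  have hxy : Gp.Adj x y := he
  let H : Gp.Subgraph :=
    { verts := {w}ᶜ
      Adj := Gp.Adj
      adj_sub := fun h => h
      edge_vert := by
        rintro a b h rfl
        exact hw _ h
      symm := Gp.symm }
  have hx : x ∈ H.verts := by
    rintro rfl
    exact hw _ hxy
  have hne : H ≠ ⊤ := by
    intro h
    have : w ∈ H.verts := by rw [h]; trivial
    exact this rfl
  have h := hSB H hne ⟨x, hx⟩
  have hc : Nat.card H.coe.edgeSet = Nat.card Gp.edgeSet := by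
    have h1 := H.image_coe_edgeSet_coe
    have h2 : H.edgeSet = Gp.edgeSet := rfl
    rw [h2] at h1
    rw [← h1]
    exact (Nat.card_image_of_injective (Sym2.map.injective Subtype.val_injective) _).symm
  unfold density at h
  rw [hc] at h
  have hpos : (0:ℝ) < Nat.card Gp.edgeSet := by
    have : Nonempty Gp.edgeSet := ⟨⟨s(x, y), he⟩⟩
    exact_mod_cast Nat.card_pos
  have hv : (0:ℝ) < Nat.card H.verts := by
    have : Nonempty H.verts := ⟨⟨x, hx⟩⟩
    exact_mod_cast Nat.card_pos
  have hle : (Nat.card H.verts : ℝ) ≤ Nat.card W := by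
    exact_mod_cast Nat.card_le_card_of_injective _ Subtype.val_injective
  have : (Nat.card Gp.edgeSet : ℝ) / Nat.card W ≤ (Nat.card Gp.edgeSet : ℝ) / Nat.card H.verts := by
    gcongr
  linarith

/-- The edge set of the copy given by an injection. -/
noncomputable def Eimg {W : Type*} [Fintype W] (Gp : SimpleGraph W) {n : ℕ} (f : W ↪ Fin n) :
    Finset (Sym2 (Fin n)) := Gp.edgeFinset.map f.sym2Map

/-- The family of edge sets of all copies in the complete graph. -/
noncomputable def Fam {W : Type*} [Fintype W] (Gp : SimpleGraph W) (n : ℕ) :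
    Finset (Finset (Sym2 (Fin n))) := Finset.univ.image (fun f : W ↪ Fin n => Eimg Gp f)

/-- The edges of the complete graph. -/
noncomputable def Kn (n : ℕ) : Finset (Sym2 (Fin n)) := (⊤ : SimpleGraph (Fin n)).edgeFinset

section
variable {W : Type*} [Fintype W] (Gp : SimpleGraph W) {n : ℕ}

lemma coe_Eimg (f : W ↪ Fin n) : (Eimg Gp f : Set (Sym2 (Fin n))) = Sym2.map f '' Gp.edgeSet := by
  simp [Eimg]

lemma mem_Eimg (f : W ↪ Fin n) (x y : Fin n) :
    s(x, y) ∈ Eimg Gp f ↔ ∃ u w, Gp.Adj u w ∧ f u = x ∧ f w = y := by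
  rw [← Finset.mem_coe, coe_Eimg]
  constructor
  · rintro ⟨e, he, h⟩
    induction e using Sym2.ind with
    | _ a b =>
    rw [Sym2.map_mk] at h
    rcases Sym2.eq_iff.1 h with ⟨h1, h2⟩ | ⟨h1, h2⟩
    · exact ⟨a, b, he, h1, h2⟩
    · exact ⟨b, a, SimpleGraph.Adj.symm he, h2, h1⟩
  · rintro ⟨u, w, h, rfl, rfl⟩
    exact ⟨s(u, w), h, rfl⟩

lemma mem_Eimg' (f : W ↪ Fin n) (u w : W) :
    s(f u, f w) ∈ Eimg Gp f ↔ Gp.Adj u w := by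
  rw [mem_Eimg]
  constructor
  · rintro ⟨a, b, h, h1, h2⟩
    rwa [← f.injective h1, ← f.injective h2]
  · intro h; exact ⟨u, w, h, rfl, rfl⟩

lemma card_Eimg (f : W ↪ Fin n) : (Eimg Gp f).card = Nat.card Gp.edgeSet := by
  rw [Eimg, Finset.card_map, Nat.card_eq_fintype_card, SimpleGraph.edgeFinset_card]

lemma Eimg_sub (f : W ↪ Fin n) : Eimg Gp f ⊆ Kn n := by
  intro e
  induction e using Sym2.ind with
  | _ x y =>
  intro h
  obtain ⟨u, w, h', rfl, rfl⟩ := (mem_Eimg Gp f x y).1 h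
  simp [Kn, h'.ne]

lemma numCopies_eq (hiso : ∀ w, ∃ u, Gp.Adj w u) (Γ : SimpleGraph (Fin n)) :
    numCopies Gp Γ = cnt (Fam Gp n) Γ.edgeFinset := by
  have key : ∀ H : Γ.Subgraph, ∀ e : Gp ≃g H.coe,
      H.edgeSet = ((Eimg Gp (e.toEquiv.toEmbedding.trans (Function.Embedding.subtype _)) :
        Finset (Sym2 (Fin n))) : Set (Sym2 (Fin n))) := by
    intro H e
    ext z
    induction z using Sym2.ind with
    | _ x y =>
    rw [Finset.mem_coe, mem_Eimg, SimpleGraph.Subgraph.mem_edgeSet]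
    constructor
    · intro h
      refine ⟨e.symm ⟨x, H.edge_vert h⟩, e.symm ⟨y, H.edge_vert h.symm⟩, ?_, ?_, ?_⟩
      · rw [e.symm.map_adj_iff]; exact h
      · change ((e (e.symm _) : H.verts) : Fin n) = x; simp
      · change ((e (e.symm _) : H.verts) : Fin n) = y; simp
    · rintro ⟨u, w, h, rfl, rfl⟩
      exact (e.map_adj_iff.2 h : H.coe.Adj (e u) (e w))
  have hvert : ∀ H : Γ.Subgraph, Nonempty (Gp ≃g H.coe) → ∀ x, x ∈ H.verts ↔ ∃ y, H.Adj x y := by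
    rintro H ⟨e⟩ x
    constructor
    · intro hx
      obtain ⟨u, hu⟩ := hiso (e.symm ⟨x, hx⟩)
      have : H.coe.Adj (e (e.symm ⟨x, hx⟩)) (e u) := e.map_adj_iff.2 hu
      rw [e.apply_symm_apply] at this
      exact ⟨_, this⟩
    · rintro ⟨y, h⟩; exact H.edge_vert h
  have hinj : Set.InjOn (fun H : Γ.Subgraph => H.edgeSet.toFinset)
      {H : Γ.Subgraph | Nonempty (Gp ≃g H.coe)} := by
    intro H hH K hK h
    have h' : H.edgeSet = K.edgeSet := by simpa using h
    have hadj : ∀ x y, H.Adj x y ↔ K.Adj x y := by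
      intro x y
      rw [← SimpleGraph.Subgraph.mem_edgeSet, h', SimpleGraph.Subgraph.mem_edgeSet]
    refine SimpleGraph.Subgraph.ext ?_ ?_
    · ext x
      rw [hvert H hH, hvert K hK]
      simp [hadj]
    · ext x y; exact hadj x y
  have himg : (fun H : Γ.Subgraph => H.edgeSet.toFinset) '' {H : Γ.Subgraph | Nonempty (Gp ≃g H.coe)}
      = ((Fam Gp n).filter (fun A => A ⊆ Γ.edgeFinset) : Finset (Finset (Sym2 (Fin n)))) := by
    ext A
    simp only [Set.mem_image, Set.mem_ofPred_eq, Finset.coe_filter, Fam, Finset.mem_image,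
      Finset.mem_univ, true_and]
    constructor
    · rintro ⟨H, ⟨e⟩, rfl⟩
      refine ⟨⟨e.toEquiv.toEmbedding.trans (Function.Embedding.subtype _), ?_⟩, ?_⟩
      · apply Finset.coe_injective
        rw [← key H e]; simp
      · intro z hz
        have : z ∈ H.edgeSet := by simpa using hz
        simpa using H.edgeSet_subset this
    · rintro ⟨⟨f, rfl⟩, hf⟩
      let c : SimpleGraph.Copy Gp Γ := ⟨⟨f, by
        intro a b hab
        have := hf ((mem_Eimg' Gp f a b).2 hab)
        simpa using this⟩, f.injective⟩
      refine ⟨c.toSubgraph, ⟨c.isoToSubgraph⟩, ?_⟩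
      apply Finset.coe_injective
      rw [coe_Eimg, Set.coe_toFinset, SimpleGraph.Subgraph.edgeSet_map]
      rfl
  unfold numCopies cnt
  rw [← Set.ncard_coe_finset, ← himg, hinj.ncard_image]
  rfl

lemma prob_eq (hiso : ∀ w, ∃ u, Gp.Adj w u) (n : ℕ) (p : ℝ) (j : ℕ) :
    probPred n p (fun Γ => numCopies Gp Γ = j) = Pj (Fam Gp n) (Kn n) p j := by
  unfold probPred Pj Ex
  rw [finsum_eq_sum_of_fintype]
  refine Finset.sum_nbij' (fun Γ => Γ.edgeFinset)
    (fun S => SimpleGraph.fromEdgeSet (S : Set (Sym2 (Fin n)))) ?_ ?_ ?_ ?_ ?_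
  · intro Γ _
    rw [Finset.mem_powerset, Kn, SimpleGraph.edgeFinset_subset_edgeFinset]
    exact le_top
  · intro S _; exact Finset.mem_univ _
  · intro Γ _; simp
  · intro S hS
    apply Finset.coe_injective
    rw [SimpleGraph.coe_edgeFinset, SimpleGraph.edgeSet_fromEdgeSet, sdiff_eq_left]
    rw [Set.disjoint_left]
    intro z hz hd
    have := Finset.mem_powerset.1 hS hz
    rw [Kn, SimpleGraph.mem_edgeFinset] at this
    exact SimpleGraph.not_isDiag_of_mem_edgeSet _ this hd
  · intro Γ _
    have h1 : edgeCount Γ = Γ.edgeFinset.card := by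
      rw [edgeCount, Nat.card_eq_fintype_card, SimpleGraph.edgeFinset_card]
    have h2 : (Kn n).card = n.choose 2 := by
      rw [Kn]
      have := SimpleGraph.card_edgeFinset_top_eq_card_choose_two (V := Fin n)
      rw [Fintype.card_fin] at this
      convert this
    beta_reduce
    rw [numCopies_eq Gp hiso, h2, weight, h1]
    split_ifs <;> simp

lemma fiber_card (hiso : ∀ w, ∃ u, Gp.Adj w u) (f : W ↪ Fin n) :
    (Finset.univ.filter (fun g : W ↪ Fin n => Eimg Gp g = Eimg Gp f)).card =
      Nat.card (Gp ≃g Gp) := by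
  rw [← Fintype.card_subtype, ← Nat.card_eq_fintype_card]
  symm
  have hcomp : ∀ φ : Gp ≃g Gp, Eimg Gp (φ.toEquiv.toEmbedding.trans f) = Eimg Gp f := by
    intro φ
    ext z
    induction z using Sym2.ind with
    | _ x y =>
    rw [mem_Eimg, mem_Eimg]
    constructor
    · rintro ⟨u, w, h, rfl, rfl⟩
      exact ⟨φ u, φ w, φ.map_adj_iff.2 h, rfl, rfl⟩
    · rintro ⟨u, w, h, rfl, rfl⟩
      refine ⟨φ.symm u, φ.symm w, φ.symm.map_adj_iff.2 h, ?_, ?_⟩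
      · change f (φ (φ.symm u)) = f u; simp
      · change f (φ (φ.symm w)) = f w; simp
  refine Nat.card_congr (Equiv.ofBijective
    (fun φ : Gp ≃g Gp => (⟨φ.toEquiv.toEmbedding.trans f, hcomp φ⟩ :
      {g : W ↪ Fin n // Eimg Gp g = Eimg Gp f})) ⟨?_, ?_⟩)
  · intro φ ψ h
    have h1 := congrArg Subtype.val h
    ext w
    exact f.injective (DFunLike.congr_fun h1 w)
  · rintro ⟨g, hg⟩
    have hr : ∀ w, ∃ u, f u = g w := by
      intro w
      obtain ⟨u, hu⟩ := hiso w
      have := (mem_Eimg' Gp g w u).2 hu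
      rw [hg, mem_Eimg] at this
      obtain ⟨a, b, _, h, _⟩ := this
      exact ⟨a, h⟩
    choose φ hφ using hr
    have hinj : Function.Injective φ := by
      intro a b hab
      apply g.injective
      rw [← hφ, ← hφ, hab]
    let e : W ≃ W := Equiv.ofBijective φ (Finite.injective_iff_bijective.1 hinj)
    refine ⟨⟨e, ?_⟩, ?_⟩
    · intro a b
      change Gp.Adj (φ a) (φ b) ↔ Gp.Adj a b
      rw [← mem_Eimg' Gp f, hφ, hφ, ← hg, mem_Eimg']
    · apply Subtype.ext
      ext w
      change ((f (φ w) : Fin n) : ℕ) = _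
      rw [hφ]

lemma sum_Fam (hiso : ∀ w, ∃ u, Gp.Adj w u) (p : ℝ) :
    ∑ A ∈ Fam Gp n, p ^ A.card =
      (n.descFactorial (Fintype.card W) : ℝ) * p ^ (Nat.card Gp.edgeSet) / Nat.card (Gp ≃g Gp) := by
  have ha : (0:ℝ) < Nat.card (Gp ≃g Gp) := by
    have : Nonempty (Gp ≃g Gp) := ⟨SimpleGraph.Iso.refl⟩
    have : Finite (Gp ≃g Gp) := Finite.of_injective (fun φ : Gp ≃g Gp => (φ : W → W)) DFunLike.coe_injective
    exact_mod_cast Nat.card_pos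
  have h := Finset.sum_comp (s := (Finset.univ : Finset (W ↪ Fin n)))
    (fun A : Finset (Sym2 (Fin n)) => p ^ A.card) (fun f => Eimg Gp f)
  have h2 : ∑ b ∈ Fam Gp n, (Finset.univ.filter (fun a : W ↪ Fin n => Eimg Gp a = b)).card • p ^ b.card
      = ∑ b ∈ Fam Gp n, (Nat.card (Gp ≃g Gp) : ℝ) * p ^ b.card := by
    refine Finset.sum_congr rfl fun b hb => ?_
    obtain ⟨f, _, rfl⟩ := Finset.mem_image.1 hb
    rw [fiber_card Gp hiso f, nsmul_eq_mul]
  rw [show Finset.image (fun f => Eimg Gp f) Finset.univ = Fam Gp n from rfl, h2,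
    ← Finset.mul_sum] at h
  simp only [card_Eimg, Finset.sum_const, Finset.card_univ, Fintype.card_embedding_eq,
    Fintype.card_fin, nsmul_eq_mul] at h
  rw [h]
  field_simp

/-- Sums over the family are dominated by sums over injections. -/
lemma sum_Fam_le (φ : Finset (Sym2 (Fin n)) → ℝ) (hφ : ∀ A, 0 ≤ φ A) :
    ∑ A ∈ Fam Gp n, φ A ≤ ∑ f : W ↪ Fin n, φ (Eimg Gp f) := by
  rw [Finset.sum_comp (s := (Finset.univ : Finset (W ↪ Fin n))) φ (fun f => Eimg Gp f)]
  refine Finset.sum_le_sum fun A hA => ?_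
  rw [nsmul_eq_mul]
  refine le_mul_of_one_le_left (hφ A) ?_
  obtain ⟨f, hf, rfl⟩ := Finset.mem_image.1 hA
  have : 0 < (Finset.univ.filter (fun a : W ↪ Fin n => Eimg Gp a = Eimg Gp f)).card :=
    Finset.card_pos.2 ⟨f, by simp⟩
  exact_mod_cast this

/-- The vertices of `g` mapped into the range of `f`. -/
noncomputable def Tset (f g : W ↪ Fin n) : Finset W :=
  Finset.univ.filter (fun w => ∃ u, f u = g w)

lemma Tset_pos (f g : W ↪ Fin n) (h : ¬ Disjoint (Eimg Gp g) (Eimg Gp f)) :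
    (Tset f g).Nonempty := by
  rw [Finset.not_disjoint_iff] at h
  obtain ⟨z, h1, h2⟩ := h
  induction z using Sym2.ind with
  | _ x y =>
  obtain ⟨u, w, _, rfl, rfl⟩ := (mem_Eimg Gp g x y).1 h1
  obtain ⟨a, b, _, h, _⟩ := (mem_Eimg Gp f _ _).1 h2
  exact ⟨u, by simp only [Tset, Finset.mem_filter, Finset.mem_univ, true_and]; exact ⟨a, h⟩⟩

lemma inter_lt (hE : Gp.edgeSet.Nonempty) (hSB : StrictlyBalanced Gp) (f g : W ↪ Fin n)
    (h : ¬ Disjoint (Eimg Gp g) (Eimg Gp f)) (hne : Eimg Gp g ≠ Eimg Gp f) :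
    (Eimg Gp f ∩ Eimg Gp g).card * Fintype.card W < Nat.card Gp.edgeSet * (Tset f g).card := by
  let H : Gp.Subgraph :=
    { verts := {w | w ∈ Tset f g}
      Adj := fun u w => Gp.Adj u w ∧ s(g u, g w) ∈ Eimg Gp f
      adj_sub := fun h => h.1
      edge_vert := by
        rintro a b ⟨_, h⟩
        obtain ⟨u, w, _, h, _⟩ := (mem_Eimg Gp f _ _).1 h
        simp only [Tset, Finset.mem_filter, Finset.mem_univ, true_and, Set.mem_ofPred_eq]
        exact ⟨u, h⟩
      symm := by
        constructor
        rintro a b ⟨h1, h2⟩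
        exact ⟨h1.symm, by rwa [Sym2.eq_swap]⟩ }
  have hTop : H ≠ ⊤ := by
    intro hH
    apply hne
    refine Finset.eq_of_subset_of_card_le ?_ (by rw [card_Eimg, card_Eimg])
    intro z
    induction z using Sym2.ind with
    | _ x y =>
    intro hz
    obtain ⟨u, w, hu, rfl, rfl⟩ := (mem_Eimg Gp g x y).1 hz
    have : H.Adj u w := by rw [hH]; exact hu
    exact this.2
  obtain ⟨t, ht⟩ := Tset_pos Gp f g h
  have hd := hSB H hTop ⟨t, ht⟩
  have hc : Nat.card H.coe.edgeSet = (Eimg Gp f ∩ Eimg Gp g).card := by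
    have h1 := H.image_coe_edgeSet_coe
    have h2 : Nat.card H.coe.edgeSet = Nat.card H.edgeSet := by
      rw [← h1]
      exact (Nat.card_image_of_injective (Sym2.map.injective Subtype.val_injective) _).symm
    have h3 : Sym2.map g '' H.edgeSet = ((Eimg Gp f ∩ Eimg Gp g : Finset _) : Set (Sym2 (Fin n))) := by
      ext z
      induction z using Sym2.ind with
      | _ x y =>
      rw [Finset.mem_coe, Finset.mem_inter]
      constructor
      · rintro ⟨e, he, hz⟩
        induction e using Sym2.ind with
        | _ a b =>
        rw [Sym2.map_mk] at hz
        rw [← hz]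
        exact ⟨he.2, (mem_Eimg' Gp g a b).2 he.1⟩
      · rintro ⟨h1, h2⟩
        obtain ⟨u, w, hu, rfl, rfl⟩ := (mem_Eimg Gp g x y).1 h2
        exact ⟨s(u, w), ⟨hu, h1⟩, rfl⟩
    rw [h2, ← Set.ncard_coe_finset, ← h3, Set.ncard_image_of_injective _ (Sym2.map.injective g.injective)]
    rfl
  have hv : Nat.card H.verts = (Tset f g).card := by
    change Nat.card {w // w ∈ Tset f g} = _
    rw [Nat.card_eq_fintype_card, Fintype.card_coe]
  unfold density at hd
  rw [hc, hv, Nat.card_eq_fintype_card (α := W)] at hd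
  have hT : (0:ℝ) < (Tset f g).card := by exact_mod_cast Finset.card_pos.2 ⟨t, ht⟩
  have hW : (0:ℝ) < Fintype.card W := by exact_mod_cast Fintype.card_pos_iff.2 ⟨t⟩
  rw [div_lt_div_iff₀ hT hW] at hd
  exact_mod_cast hd

lemma sum_T (hn : 1 ≤ n) :
    ∑ f : W ↪ Fin n, ∑ g : W ↪ Fin n, (n:ℝ) ^ (Tset f g).card ≤
      ((Fintype.card W : ℝ) + 1) ^ Fintype.card W * (n:ℝ) ^ (2 * Fintype.card W) := by
  set v := Fintype.card W
  have hn' : (1:ℝ) ≤ n := by exact_mod_cast hn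
  have h1 : ∀ f : W ↪ Fin n, ∑ g : W ↪ Fin n, (n:ℝ) ^ (Tset f g).card ≤ (((v:ℝ) + 1) * n) ^ v := by
    intro f
    let c : Fin n → ℝ := fun x => if ∃ u, f u = x then (n:ℝ) else 1
    have hc : ∀ x, 0 ≤ c x := fun x => by simp only [c]; split_ifs <;> positivity
    have e1 : ∀ g : W ↪ Fin n, (n:ℝ) ^ (Tset f g).card = ∏ w, c (g w) := by
      intro g
      simp only [c, Tset]
      rw [Finset.prod_ite]
      simp
    have e2 : ∑ g : W ↪ Fin n, ∏ w, c (g w) ≤ ∑ g : W → Fin n, ∏ w, c (g w) := by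
      rw [← Finset.sum_image (s := Finset.univ) (g := fun g : W ↪ Fin n => (g : W → Fin n))
        (f := fun g : W → Fin n => ∏ w, c (g w)) (DFunLike.coe_injective.injOn)]
      exact Finset.sum_le_sum_of_subset_of_nonneg (Finset.subset_univ _)
        fun g _ _ => Finset.prod_nonneg fun w _ => hc _
    have e3 : ∑ g : W → Fin n, ∏ w, c (g w) = (∑ x, c x) ^ v := by
      have := Finset.prod_univ_sum (fun _ : W => (Finset.univ : Finset (Fin n))) (fun _ x => c x)
      rw [Fintype.piFinset_univ] at this
      rw [← this, Finset.prod_const, Finset.card_univ]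
    have e4 : ∑ x, c x ≤ ((v:ℝ) + 1) * n := by
      have : ∀ x, c x ≤ (if ∃ u, f u = x then (n:ℝ) else 0) + 1 := fun x => by
        simp only [c]; split_ifs <;> linarith
      refine (Finset.sum_le_sum fun x _ => this x).trans ?_
      rw [Finset.sum_add_distrib, ← Finset.sum_filter, Finset.sum_const]
      have h5 : (Finset.univ.filter (fun x => ∃ u, f u = x)).card = v := by
        have : Finset.univ.filter (fun x => ∃ u, f u = x) = Finset.univ.map f := by
          ext x; simp
        rw [this, Finset.card_map, Finset.card_univ]
      rw [h5]
      simp; linarith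
    simp only [e1]
    refine e2.trans (e3.le.trans ?_)
    gcongr
  refine (Finset.sum_le_sum fun f _ => h1 f).trans ?_
  rw [Finset.sum_const, Finset.card_univ, Fintype.card_embedding_eq, Fintype.card_fin, nsmul_eq_mul]
  have h6 : ((n.descFactorial v : ℕ) : ℝ) ≤ (n:ℝ) ^ v := by
    exact_mod_cast Nat.descFactorial_le_pow n v
  calc ((n.descFactorial v : ℕ) : ℝ) * (((v:ℝ) + 1) * n) ^ v ≤ (n:ℝ) ^ v * (((v:ℝ) + 1) * n) ^ v := by
        gcongr
    _ = _ := by rw [mul_pow, two_mul, pow_add]; ring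

end
end Graphs
section Main
open scoped Classical

lemma pair_sums {W : Type*} [Fintype W] (Gp : SimpleGraph W)
    (hE : Gp.edgeSet.Nonempty) (hSB : StrictlyBalanced Gp) {n : ℕ} (hn : 1 ≤ n) {p : ℝ}
    (he0 : 0 < Nat.card Gp.edgeSet)
    (hp : p = (n : ℝ) ^ (-((Fintype.card W : ℝ) / Nat.card Gp.edgeSet))) :
    (∑ A ∈ Fam Gp n, ∑ B ∈ (Fam Gp n).filter (fun B => ¬ Disjoint B A ∧ B ≠ A), p ^ (A ∪ B).card) +
      ∑ A ∈ Fam Gp n, ∑ B ∈ (Fam Gp n).filter (fun B => ¬ Disjoint B A), p ^ A.card * p ^ B.card ≤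
    ((Fintype.card W : ℝ) + 1) ^ Fintype.card W * (n:ℝ) ^ (-(1 / (Nat.card Gp.edgeSet : ℝ))) +
    ((Fintype.card W : ℝ) + 1) ^ Fintype.card W * (n:ℝ) ^ (-(1:ℝ)) := by
  set v := Fintype.card W with hv
  set e := Nat.card Gp.edgeSet with he
  have hn' : (1:ℝ) ≤ n := by exact_mod_cast hn
  have hn0 : (0:ℝ) < n := by linarith
  have heR : (0:ℝ) < e := by exact_mod_cast he0
  have hp0 : 0 ≤ p := by rw [hp]; positivity
  have hpk : ∀ k : ℕ, p ^ k = (n:ℝ) ^ (-((v:ℝ) / e) * k) := by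
    intro k
    rw [hp, Real.rpow_mul hn0.le, Real.rpow_natCast]
  have hT := sum_T (W := W) hn
  have final : ∀ s : ℝ, ∑ f : W ↪ Fin n, ∑ g : W ↪ Fin n,
      (n:ℝ) ^ (-(2 * (v:ℝ)) - s) * (n:ℝ) ^ (Tset f g).card ≤
      ((v : ℝ) + 1) ^ v * (n:ℝ) ^ (-s) := by
    intro s
    simp only [← Finset.mul_sum]
    calc (n:ℝ) ^ (-(2 * (v:ℝ)) - s) * ∑ f : W ↪ Fin n, ∑ g : W ↪ Fin n, (n:ℝ) ^ (Tset f g).card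
        ≤ (n:ℝ) ^ (-(2 * (v:ℝ)) - s) * (((v : ℝ) + 1) ^ v * (n:ℝ) ^ (2 * v)) := by gcongr
      _ = ((v : ℝ) + 1) ^ v * ((n:ℝ) ^ (-(2 * (v:ℝ)) - s) * (n:ℝ) ^ ((2 * v : ℕ) : ℝ)) := by
          rw [Real.rpow_natCast]; ring
      _ = _ := by
          rw [← Real.rpow_add hn0]
          congr 2
          push_cast; ring
  have dom : ∀ (P : Finset (Sym2 (Fin n)) → Finset (Sym2 (Fin n)) → Prop)
      (φ : Finset (Sym2 (Fin n)) → Finset (Sym2 (Fin n)) → ℝ) (_ : ∀ A B, 0 ≤ φ A B) (s : ℝ)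
      (_ : ∀ f g : W ↪ Fin n, P (Eimg Gp f) (Eimg Gp g) → φ (Eimg Gp f) (Eimg Gp g) ≤
        (n:ℝ) ^ (-(2 * (v:ℝ)) - s) * (n:ℝ) ^ (Tset f g).card),
      ∑ A ∈ Fam Gp n, ∑ B ∈ (Fam Gp n).filter (fun B => P A B), φ A B ≤
        ((v : ℝ) + 1) ^ v * (n:ℝ) ^ (-s) := by
    intro P φ hφ s h
    refine le_trans ?_ (final s)
    have hnn : ∀ A B, 0 ≤ if P A B then φ A B else 0 := by
      intro A B; split_ifs
      · exact hφ A B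
      · exact le_rfl
    simp only [Finset.sum_filter]
    refine (sum_Fam_le Gp (fun A => ∑ B ∈ Fam Gp n, if P A B then φ A B else 0)
      (fun A => Finset.sum_nonneg fun B _ => hnn A B)).trans ?_
    refine Finset.sum_le_sum fun f _ => ?_
    refine (sum_Fam_le Gp (fun B => if P (Eimg Gp f) B then φ (Eimg Gp f) B else 0)
      (fun B => hnn _ B)).trans ?_
    refine Finset.sum_le_sum fun g _ => ?_
    by_cases hP : P (Eimg Gp f) (Eimg Gp g)
    · simp only [hP, if_true]; exact h f g hP
    · simp only [hP, if_false]; positivity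
  refine add_le_add ?_ ?_
  · have := dom (fun A B => ¬ Disjoint B A ∧ B ≠ A) (fun A B => p ^ (A ∪ B).card)
      (fun A B => by positivity) (1 / (e:ℝ)) ?_
    · refine le_trans (le_of_eq ?_) this
      congr!
    · rintro f g ⟨h1, h2⟩
      have hlt := inter_lt Gp hE hSB f g h1 h2
      rw [← he, ← hv] at hlt
      have hun := Finset.card_union_add_card_inter (Eimg Gp f) (Eimg Gp g)
      rw [card_Eimg, card_Eimg, ← he] at hun
      rw [hpk, ← Real.rpow_natCast _ (Tset f g).card, ← Real.rpow_add hn0]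
      apply Real.rpow_le_rpow_of_exponent_le hn'
      have hunR : ((Eimg Gp f ∪ Eimg Gp g).card : ℝ) = 2 * e - (Eimg Gp f ∩ Eimg Gp g).card := by
        have : ((Eimg Gp f ∪ Eimg Gp g).card : ℝ) + (Eimg Gp f ∩ Eimg Gp g).card = e + e := by
          exact_mod_cast hun
        linarith
      have hltR : ((Eimg Gp f ∩ Eimg Gp g).card : ℝ) * v + 1 ≤ e * (Tset f g).card := by
        exact_mod_cast hlt
      rw [hunR]
      have e1 : -((v:ℝ) / e) * (2 * e - (Eimg Gp f ∩ Eimg Gp g).card) =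
          -(2 * (v:ℝ)) + ((Eimg Gp f ∩ Eimg Gp g).card : ℝ) * v / e := by
        field_simp
        ring
      have e2 : ((Eimg Gp f ∩ Eimg Gp g).card : ℝ) * v / e ≤ (Tset f g).card - 1 / e := by
        rw [div_le_iff₀ heR, sub_mul, one_div, inv_mul_cancel₀ heR.ne']
        linarith
      linarith
  · have := dom (fun A B => ¬ Disjoint B A) (fun A B => p ^ A.card * p ^ B.card)
      (fun A B => by positivity) 1 ?_
    · refine le_trans (le_of_eq ?_) this
      congr!
    · intro f g h1
      have hpos : 1 ≤ (Tset f g).card := Finset.card_pos.2 (Tset_pos Gp f g h1)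
      rw [card_Eimg, card_Eimg, ← he, hpk, ← Real.rpow_natCast _ (Tset f g).card,
        ← Real.rpow_add hn0, ← Real.rpow_add hn0]
      apply Real.rpow_le_rpow_of_exponent_le hn'
      have : (1:ℝ) ≤ (Tset f g).card := by exact_mod_cast hpos
      have e1 : -((v:ℝ) / e) * e + -((v:ℝ) / e) * e = -(2 * (v:ℝ)) := by
        field_simp
        ring
      linarith

theorem poisson_aux {W : Type*} [Fintype W] (Gp : SimpleGraph W)
    (hE : Gp.edgeSet.Nonempty) (hSB : StrictlyBalanced Gp) (j : ℕ) :
      Tendsto (fun n : ℕ => probPred n ((n : ℝ) ^ (-(1 / density Gp)))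
          (fun Γ => numCopies Gp Γ = j))
        atTop
        (nhds (Real.exp (-(1 / (Nat.card (Gp ≃g Gp) : ℝ))) *
          (1 / (Nat.card (Gp ≃g Gp) : ℝ)) ^ j / (Nat.factorial j : ℝ))) := by
  have hiso := exists_adj Gp hE hSB
  have he0 : 0 < Nat.card Gp.edgeSet := by
    have : Nonempty Gp.edgeSet := hE.to_subtype
    exact Nat.card_pos
  set v := Fintype.card W with hv
  set e := Nat.card Gp.edgeSet with he
  have heR : (0:ℝ) < e := by exact_mod_cast he0
  have hdens : 1 / density Gp = (v:ℝ) / e := by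
    rw [density, Nat.card_eq_fintype_card (α := W), one_div, inv_div]
  rw [hdens]
  simp only [prob_eq Gp hiso]
  have hp0 : ∀ n : ℕ, 0 ≤ (n : ℝ) ^ (-((v:ℝ) / e)) := fun n => by positivity
  have hp1 : ∀ n : ℕ, 1 ≤ n → (n : ℝ) ^ (-((v:ℝ) / e)) ≤ 1 := fun n hn => by
    apply Real.rpow_le_one_of_one_le_of_nonpos
    · exact_mod_cast hn
    · have : 0 ≤ (v:ℝ) / e := by positivity
      linarith
  have hsub : ∀ n, ∀ A ∈ Fam Gp n, A ⊆ Kn n := by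
    intro n A hA
    obtain ⟨f, _, rfl⟩ := Finset.mem_image.1 hA
    exact Eimg_sub Gp f
  have hne : ∀ n, ∀ A ∈ Fam Gp n, A.Nonempty := by
    intro n A hA
    obtain ⟨f, _, rfl⟩ := Finset.mem_image.1 hA
    rw [← Finset.card_pos, card_Eimg]; exact he0
  refine seq_limit (fun n j => Pj (Fam Gp n) (Kn n) ((n : ℝ) ^ (-((v:ℝ) / e))) j)
    (fun n => ∑ A ∈ Fam Gp n, ((n : ℝ) ^ (-((v:ℝ) / e))) ^ A.card)
    (fun n => ((v : ℝ) + 1) ^ v * (n:ℝ) ^ (-(1 / (e : ℝ))) + ((v : ℝ) + 1) ^ v * (n:ℝ) ^ (-(1:ℝ)))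
    (1 / (Nat.card (Gp ≃g Gp) : ℝ)) ?_ ?_ ?_ ?_ ?_ ?_ j
  · have h1 : Tendsto (fun n : ℕ => (n.descFactorial v : ℝ) / (n:ℝ) ^ v) atTop (𝓝 1) := by
      have h := isEquivalent_descFactorial v
      refine (Asymptotics.isEquivalent_iff_tendsto_one ?_).1 h
      filter_upwards [eventually_ge_atTop 1] with n hn
      have : (0:ℝ) < n := by exact_mod_cast hn
      positivity
    refine (h1.div_const _).congr' ?_
    filter_upwards [eventually_ge_atTop 1] with n hn
    have hn0 : (0:ℝ) < n := by exact_mod_cast hn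
    rw [sum_Fam Gp hiso, ← hv, ← he]
    congr 1
    rw [div_eq_mul_inv]
    congr 1
    rw [← Real.rpow_natCast _ e, ← Real.rpow_mul hn0.le, neg_mul, div_mul_cancel₀ _ heR.ne',
      Real.rpow_neg hn0.le, Real.rpow_natCast]
  · have h1 : Tendsto (fun n : ℕ => (n:ℝ) ^ (-(1 / (e : ℝ)))) atTop (𝓝 0) :=
      (tendsto_rpow_neg_atTop (by positivity)).comp tendsto_natCast_atTop_atTop
    have h2 : Tendsto (fun n : ℕ => (n:ℝ) ^ (-(1:ℝ))) atTop (𝓝 0) :=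
      (tendsto_rpow_neg_atTop (by positivity)).comp tendsto_natCast_atTop_atTop
    simpa using (h1.const_mul (((v : ℝ) + 1) ^ v)).add (h2.const_mul (((v : ℝ) + 1) ^ v))
  · filter_upwards [eventually_ge_atTop 1] with n hn j
    exact Pj_nonneg _ _ (hp0 n) (hp1 n hn) j
  · filter_upwards [eventually_ge_atTop 1] with n hn M
    exact Pj_sum_le _ _ (hp0 n) (hp1 n hn) M
  · filter_upwards [eventually_ge_atTop 1] with n hn M hM
    exact Pj_sum_ge _ _ (hp0 n) (hp1 n hn) (hsub n) M hM
  · filter_upwards [eventually_ge_atTop 1] with n hn j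
    refine (recursion _ _ (hp0 n) (hp1 n hn) (hsub n) (hne n) j).trans ?_
    have := pair_sums Gp hE hSB hn he0 rfl
    convert this

end Main

/-- For a strictly balanced graph `G` and `p = n^{-1/ρ(G)}`, the number of copies of `G`
in `G(n,p)` converges in distribution to a Poisson random variable with mean `1/a(G)`. -/
theorem poisson_limit_strictly_balanced {W : Type*} [Fintype W] (Gp : SimpleGraph W)
    (hE : Gp.edgeSet.Nonempty) (hSB : StrictlyBalanced Gp) :
    ∀ j : ℕ,
      Tendsto (fun n : ℕ => probPred n ((n : ℝ) ^ (-(1 / density Gp)))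
          (fun Γ => numCopies Gp Γ = j))
        atTop
        (nhds (Real.exp (-(1 / (Nat.card (Gp ≃g Gp) : ℝ))) *
          (1 / (Nat.card (Gp ≃g Gp) : ℝ)) ^ j / (Nat.factorial j : ℝ))) :=
  fun j => poisson_aux Gp hE hSB j

end RandomGraphSpectra
end

section
/- Let 0 < α₁ < α₂ < 1, let G be a strictly balanced graph with ρ(G) < 1/α₂, let (K,T) be a pair of graphs with T ⊂ K and f_{α₁}(K,T) < 0, and let p = p(n) satisfy n^{−α₂} ≤ p ≤ n^{−α₁}. Then asymptotically almost surely the number N^{(K,T)}_G of copies of G in G(n,p) that are (K,T)-maximal in G(n,p) is positive. -/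
open Filter Topology FirstOrder

namespace RandomGraphSpectra

open Classical in
lemma edgeCount_eq {V : Type*} [Fintype V] (G : SimpleGraph V) :
    edgeCount G = G.edgeFinset.card := by
  unfold edgeCount
  rw [Nat.card_eq_fintype_card, SimpleGraph.edgeFinset_card]

open Classical in
lemma sum_weight_ge (n : ℕ) (p : ℝ) (H : SimpleGraph (Fin n)) :
    ∑ Γ : SimpleGraph (Fin n), weight n p Γ * (if H ≤ Γ then 1 else 0) = p ^ edgeCount H := by
  have hN : (⊤ : SimpleGraph (Fin n)).edgeFinset.card = n.choose 2 := by
    rw [SimpleGraph.card_edgeFinset_top_eq_card_choose_two, Fintype.card_fin]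
  have hH : H.edgeFinset ⊆ (⊤ : SimpleGraph (Fin n)).edgeFinset :=
    SimpleGraph.edgeFinset_mono le_top
  have key : ∑ Γ ∈ Finset.univ.filter (fun Γ : SimpleGraph (Fin n) => H ≤ Γ), weight n p Γ =
      ∑ s ∈ ((⊤ : SimpleGraph (Fin n)).edgeFinset \ H.edgeFinset).powerset,
        p ^ edgeCount H * (p ^ s.card *
          (1 - p) ^ (((⊤ : SimpleGraph (Fin n)).edgeFinset \ H.edgeFinset).card - s.card)) := by
    refine Finset.sum_bij (fun Γ _ => Γ.edgeFinset \ H.edgeFinset) ?_ ?_ ?_ ?_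
    · intro Γ _
      rw [Finset.mem_powerset]
      exact Finset.sdiff_subset_sdiff (SimpleGraph.edgeFinset_mono le_top) le_rfl
    · intro Γ₁ h1 Γ₂ h2 h
      simp only [Finset.mem_filter, Finset.mem_univ, true_and] at h1 h2
      have e1 := Finset.sdiff_union_of_subset (SimpleGraph.edgeFinset_mono h1)
      have e2 := Finset.sdiff_union_of_subset (SimpleGraph.edgeFinset_mono h2)
      rw [← SimpleGraph.edgeFinset_inj, ← e1, ← e2]
      change Γ₁.edgeFinset \ H.edgeFinset = Γ₂.edgeFinset \ H.edgeFinset at h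
      rw [h]
    · intro s hs
      rw [Finset.mem_powerset] at hs
      have hd : ∀ e ∈ s, ¬ e.IsDiag := by
        intro e he
        have := Finset.mem_sdiff.1 (hs he)
        exact SimpleGraph.not_isDiag_of_mem_edgeFinset this.1
      have hes : (SimpleGraph.fromEdgeSet ((s : Set (Sym2 (Fin n))) ∪ H.edgeSet)).edgeSet =
          (s : Set (Sym2 (Fin n))) ∪ H.edgeSet := by
        rw [SimpleGraph.edgeSet_fromEdgeSet]
        ext e
        simp only [Set.mem_sdiff, Set.mem_union, Finset.mem_coe]
        constructor
        · exact fun h => h.1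
        · intro h
          refine ⟨h, ?_⟩
          rcases h with h | h
          · exact hd e h
          · exact SimpleGraph.not_isDiag_of_mem_edgeSet _ h
      refine ⟨SimpleGraph.fromEdgeSet ((s : Set (Sym2 (Fin n))) ∪ H.edgeSet), ?_, ?_⟩
      · simp only [Finset.mem_filter, Finset.mem_univ, true_and]
        rw [← SimpleGraph.edgeSet_subset_edgeSet, hes]
        exact Set.subset_union_right
      · ext e
        simp only [Finset.mem_sdiff, SimpleGraph.mem_edgeFinset, hes, Set.mem_union,
          Finset.mem_coe]
        constructor
        · tauto
        · intro he
          have := Finset.mem_sdiff.1 (hs he)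
          rw [SimpleGraph.mem_edgeFinset, SimpleGraph.mem_edgeFinset] at this
          exact ⟨Or.inl he, this.2⟩
    · intro Γ h1
      simp only [Finset.mem_filter, Finset.mem_univ, true_and] at h1
      have hs := SimpleGraph.edgeFinset_mono h1
      unfold weight
      rw [edgeCount_eq, edgeCount_eq, Finset.card_sdiff_of_subset hs,
        Finset.card_sdiff_of_subset hH, hN]
      have h2 := Finset.card_le_card hs
      have h3 := Finset.card_le_card (SimpleGraph.edgeFinset_mono (le_top (a := Γ)))
      rw [hN] at h3
      rw [← mul_assoc, ← pow_add]
      congr 2 <;> omega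
  have : ∀ Γ : SimpleGraph (Fin n), weight n p Γ * (if H ≤ Γ then 1 else 0) =
      if H ≤ Γ then weight n p Γ else 0 := by
    intro Γ; split_ifs <;> simp
  simp_rw [this]
  rw [← Finset.sum_filter, key, ← Finset.mul_sum, Finset.sum_pow_mul_eq_add_pow]
  simp

lemma sum_weight (n : ℕ) (p : ℝ) : ∑ Γ : SimpleGraph (Fin n), weight n p Γ = 1 := by
  have := sum_weight_ge n p ⊥
  simpa [edgeCount] using this

lemma weight_nonneg (n : ℕ) (p : ℝ) (h0 : 0 ≤ p) (h1 : p ≤ 1) (Γ : SimpleGraph (Fin n)) :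
    0 ≤ weight n p Γ :=
  mul_nonneg (pow_nonneg h0 _) (pow_nonneg (by linarith) _)

open Classical in
/-- Second-moment bound: if the failure of `P` forces `X ≤ Y`. -/
lemma prob_lower (n : ℕ) (p : ℝ) (h0 : 0 ≤ p) (h1 : p ≤ 1) (P : SimpleGraph (Fin n) → Prop)
    (X Y : SimpleGraph (Fin n) → ℝ) (μ : ℝ) (hμ : 0 < μ)
    (hY : ∀ Γ, 0 ≤ Y Γ) (hXY : ∀ Γ, ¬ P Γ → X Γ ≤ Y Γ)
    (hX1 : ∑ Γ, weight n p Γ * X Γ = μ) :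
    1 - (2 / μ * ∑ Γ, weight n p Γ * Y Γ +
      4 / μ ^ 2 * (∑ Γ, weight n p Γ * X Γ ^ 2 - μ ^ 2)) ≤ probPred n p P := by
  unfold probPred
  rw [finsum_eq_sum_of_fintype]
  have e : 1 - (2 / μ * ∑ Γ, weight n p Γ * Y Γ +
      4 / μ ^ 2 * (∑ Γ, weight n p Γ * X Γ ^ 2 - μ ^ 2)) =
      ∑ Γ, weight n p Γ * (1 - (2 / μ * Y Γ + 4 / μ ^ 2 * (X Γ - μ) ^ 2)) := by
    have : ∀ Γ, weight n p Γ * (1 - (2 / μ * Y Γ + 4 / μ ^ 2 * (X Γ - μ) ^ 2)) =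
       weight n p Γ - 2 / μ * (weight n p Γ * Y Γ) - 4 / μ ^ 2 * (weight n p Γ * X Γ ^ 2)
        + 8 / μ ^ 2 * μ * (weight n p Γ * X Γ) - 4 / μ ^ 2 * μ ^ 2 * weight n p Γ := by
      intro Γ; ring
    simp_rw [this]
    simp only [Finset.sum_sub_distrib, Finset.sum_add_distrib, ← Finset.mul_sum, hX1,
      sum_weight]
    ring
  rw [e]
  apply Finset.sum_le_sum
  intro Γ _
  have hw := weight_nonneg n p h0 h1 Γ
  have a1 : 0 ≤ 2 / μ * Y Γ := mul_nonneg (by positivity) (hY Γ)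
  have a2 : 0 ≤ 4 / μ ^ 2 * (X Γ - μ) ^ 2 := by positivity
  split_ifs with hP
  · nlinarith
  · have hx := hXY Γ hP
    have : 1 ≤ 2 / μ * Y Γ + 4 / μ ^ 2 * (X Γ - μ) ^ 2 := by
      by_cases hh : μ / 2 ≤ Y Γ
      · have : 1 ≤ 2 / μ * Y Γ := by
          rw [div_mul_eq_mul_div, le_div_iff₀ hμ]; linarith
        linarith
      · push Not at hh
        have : 1 ≤ 4 / μ ^ 2 * (X Γ - μ) ^ 2 := by
          rw [div_mul_eq_mul_div, le_div_iff₀ (by positivity)]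
          nlinarith
        linarith
    nlinarith

lemma prob_upper (n : ℕ) (p : ℝ) (h0 : 0 ≤ p) (h1 : p ≤ 1) (P : SimpleGraph (Fin n) → Prop) :
    probPred n p P ≤ 1 := by
  unfold probPred
  rw [finsum_eq_sum_of_fintype, ← sum_weight n p]
  apply Finset.sum_le_sum
  intro Γ _
  have hw := weight_nonneg n p h0 h1 Γ
  split_ifs <;> linarith

lemma edgeCount_map {V V' : Type*} [Fintype V] [Fintype V'] (G : SimpleGraph V) (f : V ↪ V') :
    edgeCount (G.map f) = edgeCount G := by
  classical
  rw [edgeCount_eq, edgeCount_eq]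
  convert SimpleGraph.card_edgeFinset_map f G

lemma edgeCount_mono {V : Type*} [Fintype V] {G H : SimpleGraph V} (h : G ≤ H) :
    edgeCount G ≤ edgeCount H := by
  classical
  rw [edgeCount_eq, edgeCount_eq]
  exact Finset.card_le_card (SimpleGraph.edgeFinset_mono h)

lemma edgeCount_sup_inf {V : Type*} [Fintype V] (G H : SimpleGraph V) :
    edgeCount (G ⊔ H) + edgeCount (G ⊓ H) = edgeCount G + edgeCount H := by
  classical
  simp only [edgeCount_eq, SimpleGraph.edgeFinset_sup, SimpleGraph.edgeFinset_inf]
  exact Finset.card_union_add_card_inter _ _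

lemma edgeCount_bot {V : Type*} : edgeCount (⊥ : SimpleGraph V) = 0 := by
  simp [edgeCount]

lemma card_emb_le {U : Type*} [Fintype U] (n : ℕ) (A : Finset (Fin n)) (S : Finset U)
    (B : Finset (U ↪ Fin n)) (hB : ∀ h ∈ B, ∀ u ∈ S, h u ∈ A) :
    B.card ≤ A.card ^ S.card * n ^ (Fintype.card U - S.card) := by
  classical
  have h1 : B.card = (B.map ⟨fun h : U ↪ Fin n => (h : U → Fin n), DFunLike.coe_injective⟩).card :=
    (Finset.card_map _).symm
  rw [h1]
  refine (Finset.card_le_card (t := Fintype.piFinset (fun u => if u ∈ S then A else Finset.univ))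
    ?_).trans ?_
  · intro g hg
    obtain ⟨h, hh, rfl⟩ := Finset.mem_map.1 hg
    rw [Fintype.mem_piFinset]
    intro u
    split_ifs with hu
    · exact hB h hh u hu
    · exact Finset.mem_univ _
  · rw [Fintype.card_piFinset]
    have : ∀ u, (if u ∈ S then A else (Finset.univ : Finset (Fin n))).card =
      if u ∈ S then A.card else n := by
      intro u; split_ifs <;> simp
    simp_rw [this]
    rw [Finset.prod_ite, Finset.prod_const, Finset.prod_const]
    apply le_of_eq
    congr 2
    · congr 1; ext; simp
    · rw [← Finset.card_compl]; congr 1; ext; simp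

end RandomGraphSpectra
namespace RandomGraphSpectra

/-- Number of edges of `G` inside `S`. -/
noncomputable def eIn {W : Type*} (G : SimpleGraph W) (S : Finset W) : ℕ :=
  edgeCount ((⊤ : G.Subgraph).induce (S : Set W)).spanningCoe

lemma eIn_empty {W : Type*} (G : SimpleGraph W) : eIn G ∅ = 0 := by
  have : ((⊤ : G.Subgraph).induce ((∅ : Finset W) : Set W)).spanningCoe = ⊥ := by
    ext a b
    simp
  unfold eIn
  rw [this, edgeCount_bot]

open Classical in
/-- Vertices whose `g`-image meets the range of `f`. -/
noncomputable def meetSet {W : Type*} [Fintype W] {n : ℕ} (f g : W ↪ Fin n) : Finset W :=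
  Finset.univ.filter (fun w => g w ∈ Finset.univ.map f)

lemma two_e_le {W : Type*} [Fintype W] (G : SimpleGraph W) {n : ℕ} (f g : W ↪ Fin n) :
    2 * edgeCount G ≤ edgeCount (G.map f ⊔ G.map g) + eIn G (meetSet f g) := by
  classical
  have h1 := edgeCount_sup_inf (G.map f) (G.map g)
  rw [edgeCount_map, edgeCount_map] at h1
  have h2 : edgeCount (G.map f ⊓ G.map g) ≤ eIn G (meetSet f g) := by
    unfold eIn
    rw [← edgeCount_map (((⊤ : G.Subgraph).induce (meetSet f g : Set W)).spanningCoe) g]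
    apply edgeCount_mono
    intro a b hab
    obtain ⟨hf, hg⟩ := (SimpleGraph.inf_adj _ _ _ _).1 hab
    rw [SimpleGraph.map_adj] at hf hg
    obtain ⟨x, y, hxy, rfl, rfl⟩ := hg
    obtain ⟨x', y', hxy', hx, hy⟩ := hf
    rw [SimpleGraph.map_adj]
    refine ⟨x, y, ?_, rfl, rfl⟩
    simp only [SimpleGraph.Subgraph.spanningCoe_adj, SimpleGraph.Subgraph.induce_adj,
      SimpleGraph.Subgraph.top_adj, meetSet]
    refine ⟨?_, ?_, hxy⟩
    · simpa using ⟨x', hx⟩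
    · simpa using ⟨y', hy⟩
  omega

open Classical in
lemma second_moment {W : Type*} [Fintype W] (G : SimpleGraph W) (n : ℕ) (p : ℝ)
    (h0 : 0 < p) (h1 : p ≤ 1) :
    ∑ f : W ↪ Fin n, ∑ g : W ↪ Fin n, p ^ edgeCount (G.map f ⊔ G.map g) ≤
      (∑ _f : W ↪ Fin n, p ^ edgeCount G) ^ 2 +
      ∑ S ∈ (Finset.univ : Finset (Finset W)).filter (·.Nonempty),
        (n : ℝ) ^ Fintype.card W * ((Fintype.card W : ℝ) ^ S.card *
          (n : ℝ) ^ (Fintype.card W - S.card)) * (p ^ (2 * edgeCount G) / p ^ eIn G S) := by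
  set e := edgeCount G
  have hterm : ∀ f g : W ↪ Fin n, p ^ edgeCount (G.map f ⊔ G.map g) ≤
      p ^ (2 * e) + ∑ S ∈ (Finset.univ : Finset (Finset W)).filter (·.Nonempty),
        if meetSet f g = S then p ^ (2 * e) / p ^ eIn G S else 0 := by
    intro f g
    have hb : p ^ edgeCount (G.map f ⊔ G.map g) ≤ p ^ (2 * e) / p ^ eIn G (meetSet f g) := by
      rw [le_div_iff₀ (by positivity), ← pow_add]
      exact pow_le_pow_of_le_one h0.le h1 (two_e_le G f g)
    by_cases hS : (meetSet f g).Nonempty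
    · rw [Finset.sum_ite_eq, if_pos (by simpa using hS)]
      have : 0 ≤ p ^ (2 * e) := by positivity
      linarith
    · rw [Finset.not_nonempty_iff_eq_empty] at hS
      rw [hS, eIn_empty, pow_zero, div_one] at hb
      have : 0 ≤ ∑ S ∈ (Finset.univ : Finset (Finset W)).filter (·.Nonempty),
        if meetSet f g = S then p ^ (2 * e) / p ^ eIn G S else 0 := by
        apply Finset.sum_nonneg
        intro S _
        split_ifs <;> positivity
      linarith
  have hcount : ∀ (f : W ↪ Fin n) (S : Finset W),
      ((Finset.univ.filter (fun g : W ↪ Fin n => meetSet f g = S)).card : ℝ) ≤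
      (Fintype.card W : ℝ) ^ S.card * (n : ℝ) ^ (Fintype.card W - S.card) := by
    intro f S
    have := card_emb_le n (Finset.univ.map f) S
      (Finset.univ.filter (fun g : W ↪ Fin n => meetSet f g = S)) (by
        intro g hg w hw
        simp only [Finset.mem_filter, Finset.mem_univ, true_and] at hg
        rw [← hg] at hw
        exact (Finset.mem_filter.1 hw).2)
    rw [Finset.card_map, Finset.card_univ] at this
    exact_mod_cast this
  have hemb : (Fintype.card (W ↪ Fin n) : ℝ) ≤ (n : ℝ) ^ Fintype.card W := by
    rw [Fintype.card_embedding_eq, Fintype.card_fin]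
    exact_mod_cast Nat.descFactorial_le_pow _ _
  calc _ ≤ ∑ f : W ↪ Fin n, ∑ g : W ↪ Fin n, (p ^ (2 * e) +
        ∑ S ∈ (Finset.univ : Finset (Finset W)).filter (·.Nonempty),
        if meetSet f g = S then p ^ (2 * e) / p ^ eIn G S else 0) :=
        Finset.sum_le_sum fun f _ => Finset.sum_le_sum fun g _ => hterm f g
    _ = (∑ _f : W ↪ Fin n, p ^ e) ^ 2 +
        ∑ S ∈ (Finset.univ : Finset (Finset W)).filter (·.Nonempty),
        ∑ f : W ↪ Fin n, ∑ g : W ↪ Fin n,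
        (if meetSet f g = S then p ^ (2 * e) / p ^ eIn G S else 0) := by
        simp only [Finset.sum_add_distrib]
        congr 1
        · simp only [Finset.sum_const, nsmul_eq_mul]; ring
        · rw [Finset.sum_comm]
          simp_rw [Finset.sum_comm (s := (Finset.univ : Finset (W ↪ Fin n)))
            (t := (Finset.univ : Finset (Finset W)).filter (·.Nonempty))]
          refine Finset.sum_congr rfl fun S _ => ?_
          rw [Finset.sum_comm]
    _ ≤ _ := by
        gcongr with S hS
        calc _ ≤ ∑ _f : W ↪ Fin n, ((Fintype.card W : ℝ) ^ S.card *
              (n : ℝ) ^ (Fintype.card W - S.card)) * (p ^ (2 * e) / p ^ eIn G S) := by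
              refine Finset.sum_le_sum fun f _ => ?_
              rw [← Finset.sum_filter, Finset.sum_const, nsmul_eq_mul]
              exact mul_le_mul_of_nonneg_right (hcount f S) (by positivity)
          _ ≤ _ := by
              rw [Finset.sum_const, nsmul_eq_mul, Finset.card_univ, ← mul_assoc]
              gcongr

open Classical in
/-- Index set of potential (copy, bad extension) pairs. -/
noncomputable def badPairs {W U : Type*} [Fintype W] [Fintype U] (K' : SimpleGraph U)
    (Tv : Finset U) (n : ℕ) : Finset ((W ↪ Fin n) × (U ↪ Fin n)) :=
  Finset.univ.filter (fun x => (∀ u, u ∈ Tv ↔ x.2 u ∈ Finset.univ.map x.1) ∧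
    ∀ a b, K'.Adj a b → ¬ (a ∈ Tv ∧ b ∈ Tv))

lemma mem_badPairs {W U : Type*} [Fintype W] [Fintype U] (K' : SimpleGraph U)
    (Tv : Finset U) (n : ℕ) (x : (W ↪ Fin n) × (U ↪ Fin n)) :
    x ∈ badPairs K' Tv n ↔ (∀ u, u ∈ Tv ↔ x.2 u ∈ Finset.univ.map x.1) ∧
      ∀ a b, K'.Adj a b → ¬ (a ∈ Tv ∧ b ∈ Tv) := by
  simp [badPairs]

lemma badPairs_card {W U : Type*} [Fintype W] [Fintype U] (K' : SimpleGraph U)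
    (Tv : Finset U) (n : ℕ) :
    ((badPairs (W := W) K' Tv n).card : ℝ) ≤ (n : ℝ) ^ Fintype.card W *
      ((Fintype.card W : ℝ) ^ Tv.card * (n : ℝ) ^ (Fintype.card U - Tv.card)) := by
  classical
  have hemb : (Fintype.card (W ↪ Fin n) : ℝ) ≤ (n : ℝ) ^ Fintype.card W := by
    rw [Fintype.card_embedding_eq, Fintype.card_fin]
    exact_mod_cast Nat.descFactorial_le_pow _ _
  have h := Finset.card_eq_sum_card_fiberwise (s := badPairs (W := W) K' Tv n)
    (t := (Finset.univ : Finset (W ↪ Fin n))) (f := Prod.fst) (fun _ _ => by simp)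
  have h2 : ∀ f : W ↪ Fin n, ((badPairs (W := W) K' Tv n).filter (fun x => x.1 = f)).card ≤
      Fintype.card W ^ Tv.card * n ^ (Fintype.card U - Tv.card) := by
    intro f
    have := card_emb_le n (Finset.univ.map f) Tv
      (((badPairs (W := W) K' Tv n).filter (fun x => x.1 = f)).image Prod.snd) (by
        intro g hg w hw
        obtain ⟨x, hx, rfl⟩ := Finset.mem_image.1 hg
        obtain ⟨hx1, rfl⟩ := Finset.mem_filter.1 hx
        exact ((Finset.mem_filter.1 hx1).2.1 w).1 hw)
    rw [Finset.card_map, Finset.card_univ, Finset.card_image_of_injOn] at this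
    · exact this
    · intro x hx y hy hxy
      have h1 := (Finset.mem_filter.1 hx).2
      have h2 := (Finset.mem_filter.1 hy).2
      exact Prod.ext (h1.trans h2.symm) hxy
  have h3 : (badPairs (W := W) K' Tv n).card ≤ Fintype.card (W ↪ Fin n) *
      (Fintype.card W ^ Tv.card * n ^ (Fintype.card U - Tv.card)) := by
    rw [h]
    refine (Finset.sum_le_sum fun f _ => h2 f).trans ?_
    rw [Finset.sum_const, Finset.card_univ, smul_eq_mul]
  calc ((badPairs (W := W) K' Tv n).card : ℝ) ≤ (Fintype.card (W ↪ Fin n) : ℝ) *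
      ((Fintype.card W : ℝ) ^ Tv.card * (n : ℝ) ^ (Fintype.card U - Tv.card)) := by
        exact_mod_cast h3
    _ ≤ _ := by gcongr

lemma edgeCount_badPair {W U : Type*} [Fintype W] [Fintype U] (G : SimpleGraph W)
    (K' : SimpleGraph U) (Tv : Finset U) (n : ℕ) (x : (W ↪ Fin n) × (U ↪ Fin n))
    (hx : x ∈ badPairs K' Tv n) :
    edgeCount (G.map x.1 ⊔ K'.map x.2) = edgeCount G + edgeCount K' := by
  classical
  have h1 := edgeCount_sup_inf (G.map x.1) (K'.map x.2)
  rw [edgeCount_map, edgeCount_map] at h1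
  have : G.map x.1 ⊓ K'.map x.2 = ⊥ := by
    rw [eq_bot_iff]
    intro a b hab
    obtain ⟨hf, hg⟩ := (SimpleGraph.inf_adj _ _ _ _).1 hab
    rw [SimpleGraph.map_adj] at hf hg
    obtain ⟨u, v, huv, rfl, rfl⟩ := hg
    obtain ⟨c, d, hcd, hc, hd⟩ := hf
    obtain ⟨-, hx1, hx2⟩ := Finset.mem_filter.1 hx
    exact hx2 u v huv ⟨(hx1 u).2 (by simpa using ⟨c, hc⟩), (hx1 v).2 (by simpa using ⟨d, hd⟩)⟩
  rw [this, edgeCount_bot] at h1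
  exact h1

open Classical in
/-- The finite-`n` estimate. -/
lemma finite_bound {W U : Type*} [Fintype W] [Fintype U] (G : SimpleGraph W)
    (K' : SimpleGraph U) (Tv : Finset U) (n : ℕ) (p : ℝ) (h0 : 0 < p) (h1 : p ≤ 1)
    (hn : 2 * Fintype.card W ≤ n) (hn1 : 1 ≤ n)
    (P : SimpleGraph (Fin n) → Prop)
    (hP : ∀ Γ, ¬ P Γ → ∀ f : W ↪ Fin n, G.map f ≤ Γ →
      ∃ h : U ↪ Fin n, (f, h) ∈ badPairs K' Tv n ∧ K'.map h ≤ Γ) :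
    1 - (2 * 2 ^ Fintype.card W * ((Fintype.card W : ℝ) ^ Tv.card *
          ((n : ℝ) ^ (Fintype.card U - Tv.card) * p ^ edgeCount K')) +
        4 * 4 ^ Fintype.card W *
        ∑ S ∈ (Finset.univ : Finset (Finset W)).filter (·.Nonempty),
          (Fintype.card W : ℝ) ^ S.card * ((n : ℝ) ^ S.card * p ^ eIn G S)⁻¹) ≤ probPred n p P := by
  set v := Fintype.card W with hv
  set e := edgeCount G with he
  set X : SimpleGraph (Fin n) → ℝ := fun Γ => ∑ f : W ↪ Fin n, if G.map f ≤ Γ then 1 else 0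
    with hX
  set Y : SimpleGraph (Fin n) → ℝ := fun Γ => ∑ x ∈ badPairs (W := W) K' Tv n,
    if G.map x.1 ⊔ K'.map x.2 ≤ Γ then 1 else 0 with hY
  set μ : ℝ := ∑ _f : W ↪ Fin n, p ^ e with hμ
  have hn0 : (0 : ℝ) < n := by exact_mod_cast hn1
  set M : ℝ := (n : ℝ) ^ v * p ^ e with hM
  have hMpos : 0 < M := by positivity
  have hμM : M ≤ 2 ^ v * μ := by
    rw [hμ, Finset.sum_const, nsmul_eq_mul, Finset.card_univ, Fintype.card_embedding_eq,
      Fintype.card_fin, ← hv, hM, ← mul_assoc]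
    gcongr
    have h3 : (n + 1 - v) ^ v ≤ n.descFactorial v := Nat.pow_sub_le_descFactorial n v
    have h4 : n ^ v ≤ 2 ^ v * n.descFactorial v :=
      calc n ^ v ≤ (2 * (n + 1 - v)) ^ v := Nat.pow_le_pow_left (by omega) _
        _ = 2 ^ v * (n + 1 - v) ^ v := mul_pow _ _ _
        _ ≤ _ := Nat.mul_le_mul_left _ h3
    exact_mod_cast h4
  have hμpos : 0 < μ := by
    by_contra hc
    push Not at hc
    have : (2 : ℝ) ^ v * μ ≤ 0 := mul_nonpos_of_nonneg_of_nonpos (by positivity) hc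
    linarith
  have hX1 : ∑ Γ, weight n p Γ * X Γ = μ := by
    simp only [hX, Finset.mul_sum]
    rw [Finset.sum_comm]
    refine Finset.sum_congr rfl fun f _ => ?_
    rw [sum_weight_ge, edgeCount_map]
  have hX2 : ∑ Γ, weight n p Γ * X Γ ^ 2 =
      ∑ f : W ↪ Fin n, ∑ g : W ↪ Fin n, p ^ edgeCount (G.map f ⊔ G.map g) := by
    have : ∀ Γ, X Γ ^ 2 = ∑ f : W ↪ Fin n, ∑ g : W ↪ Fin n,
        if G.map f ⊔ G.map g ≤ Γ then (1 : ℝ) else 0 := by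
      intro Γ
      rw [hX, sq, Finset.sum_mul_sum]
      refine Finset.sum_congr rfl fun f _ => Finset.sum_congr rfl fun g _ => ?_
      rw [sup_le_iff]
      split_ifs <;> simp_all
    simp_rw [this, Finset.mul_sum]
    rw [Finset.sum_comm]
    refine Finset.sum_congr rfl fun f _ => ?_
    rw [Finset.sum_comm]
    refine Finset.sum_congr rfl fun g _ => ?_
    rw [sum_weight_ge]
  have hYE : ∑ Γ, weight n p Γ * Y Γ ≤ M * ((v : ℝ) ^ Tv.card *
          ((n : ℝ) ^ (Fintype.card U - Tv.card) * p ^ edgeCount K')) := by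
    have : ∑ Γ, weight n p Γ * Y Γ =
        ((badPairs (W := W) K' Tv n).card : ℝ) * (p ^ e * p ^ edgeCount K') := by
      simp only [hY, Finset.mul_sum]
      rw [Finset.sum_comm, ← nsmul_eq_mul, ← Finset.sum_const]
      refine Finset.sum_congr rfl fun x hx => ?_
      rw [sum_weight_ge, edgeCount_badPair G K' Tv n x hx, pow_add]
    rw [this]
    calc _ ≤ ((n : ℝ) ^ v * ((v : ℝ) ^ Tv.card * (n : ℝ) ^ (Fintype.card U - Tv.card))) *
          (p ^ e * p ^ edgeCount K') := by
          apply mul_le_mul_of_nonneg_right (badPairs_card K' Tv n) (by positivity)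
      _ = _ := by rw [hM]; ring
  have hXE : ∑ Γ, weight n p Γ * X Γ ^ 2 - μ ^ 2 ≤ M ^ 2 *
      ∑ S ∈ (Finset.univ : Finset (Finset W)).filter (·.Nonempty),
          (v : ℝ) ^ S.card * ((n : ℝ) ^ S.card * p ^ eIn G S)⁻¹ := by
    have h := second_moment G n p h0 h1
    rw [hX2]
    have h5 : ∑ S ∈ (Finset.univ : Finset (Finset W)).filter (·.Nonempty),
        (n : ℝ) ^ Fintype.card W * ((Fintype.card W : ℝ) ^ S.card *
          (n : ℝ) ^ (Fintype.card W - S.card)) * (p ^ (2 * edgeCount G) / p ^ eIn G S) =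
        M ^ 2 * ∑ S ∈ (Finset.univ : Finset (Finset W)).filter (·.Nonempty),
          (v : ℝ) ^ S.card * ((n : ℝ) ^ S.card * p ^ eIn G S)⁻¹ := by
      rw [Finset.mul_sum]
      refine Finset.sum_congr rfl fun S _ => ?_
      rw [← hv, ← he, hM, pow_sub₀ _ hn0.ne' (by rw [hv]; exact Finset.card_le_univ S)]
      field_simp
      ring
    rw [h5] at h
    linarith
  have hlow := prob_lower n p h0.le h1 P X Y μ hμpos (fun Γ => by
      rw [hY]; exact Finset.sum_nonneg fun x _ => by split_ifs <;> norm_num) (by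
      intro Γ hΓ
      simp only [hX, hY, Finset.sum_boole]
      have : (Finset.univ.filter (fun f : W ↪ Fin n => G.map f ≤ Γ)) ⊆
          ((badPairs (W := W) K' Tv n).filter
            (fun x => G.map x.1 ⊔ K'.map x.2 ≤ Γ)).image Prod.fst := by
        intro f hf
        have hf' := (Finset.mem_filter.1 hf).2
        obtain ⟨h, hh1, hh2⟩ := hP Γ hΓ f hf'
        exact Finset.mem_image.2 ⟨(f, h), Finset.mem_filter.2 ⟨hh1, sup_le hf' hh2⟩, rfl⟩
      exact_mod_cast (Finset.card_le_card this).trans Finset.card_image_le) hX1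
  refine le_trans ?_ hlow
  set a := (v : ℝ) ^ Tv.card * ((n : ℝ) ^ (Fintype.card U - Tv.card) * p ^ edgeCount K')
  set b := ∑ S ∈ (Finset.univ : Finset (Finset W)).filter (·.Nonempty),
          (v : ℝ) ^ S.card * ((n : ℝ) ^ S.card * p ^ eIn G S)⁻¹
  have ha : 0 ≤ a := by positivity
  have hb : 0 ≤ b := Finset.sum_nonneg fun S _ => by positivity
  have i1 : 2 / μ * ∑ Γ, weight n p Γ * Y Γ ≤ 2 * 2 ^ v * a := by
    calc _ ≤ 2 / μ * ((2 ^ v * μ) * a) := by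
          gcongr
          exact hYE.trans (by gcongr)
      _ = _ := by field_simp
  have i2 : 4 / μ ^ 2 * (∑ Γ, weight n p Γ * X Γ ^ 2 - μ ^ 2) ≤ 4 * 4 ^ v * b := by
    calc _ ≤ 4 / μ ^ 2 * ((2 ^ v * μ) ^ 2 * b) := by
          gcongr
          exact hXE.trans (by gcongr)
      _ = _ := by
          have : (4 : ℝ) ^ v = (2 ^ v) ^ 2 := by rw [← pow_mul, mul_comm, pow_mul]; norm_num
          rw [this]
          field_simp
  linarith

end RandomGraphSpectra

namespace RandomGraphSpectra

open Filter Topology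

lemma card_coe_edgeSet {V : Type*} {G : SimpleGraph V} (H : G.Subgraph) :
    Nat.card H.coe.edgeSet = Nat.card H.edgeSet := by
  rw [← SimpleGraph.Subgraph.image_coe_edgeSet_coe]
  exact (Nat.card_image_of_injective (Sym2.map.injective Subtype.val_injective) _).symm

lemma eIn_lt {W : Type*} [Fintype W] (α : ℝ) (hα : 0 < α) (G : SimpleGraph W)
    (hSB : StrictlyBalanced G) (hρ : density G < 1 / α) (S : Finset W) (hS : S.Nonempty) :
    0 < (S.card : ℝ) - α * eIn G S := by
  set H := (⊤ : G.Subgraph).induce (S : Set W) with hH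
  have hd : density H.coe < 1 / α := by
    by_cases h : H = ⊤
    · have : density H.coe = density G := by
        unfold density
        rw [card_coe_edgeSet, h]
        simp
      rw [this]; exact hρ
    · exact (hSB H h (by simpa [hH] using hS)).trans hρ
  unfold density at hd
  rw [card_coe_edgeSet] at hd
  have h1 : Nat.card H.edgeSet = eIn G S := rfl
  have h2 : Nat.card H.verts = S.card := by simp [hH]
  rw [h1, h2] at hd
  have hc : (0 : ℝ) < S.card := by exact_mod_cast hS.card_pos
  rw [div_lt_div_iff₀ hc hα] at hd
  linarith

lemma edgeCount_sdiff {U : Type*} [Fintype U] (K : SimpleGraph U) (T : K.Subgraph) :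
    (edgeCount (K \ T.spanningCoe) : ℝ) =
      (Nat.card (⊤ : K.Subgraph).edgeSet : ℝ) - (Nat.card T.edgeSet : ℝ) := by
  have h := edgeCount_sup_inf (K \ T.spanningCoe) T.spanningCoe
  rw [sdiff_sup_cancel T.spanningCoe_le, (disjoint_sdiff_self_left :
    Disjoint (K \ T.spanningCoe) T.spanningCoe).eq_bot, edgeCount_bot] at h
  have h1 : edgeCount T.spanningCoe = Nat.card T.edgeSet := rfl
  have h2 : edgeCount K = Nat.card (⊤ : K.Subgraph).edgeSet := by
    rw [SimpleGraph.Subgraph.edgeSet_top]; rfl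
  rw [h1, h2] at h
  have : ((Nat.card (⊤ : K.Subgraph).edgeSet + 0 : ℕ) : ℝ) =
    ((edgeCount (K \ T.spanningCoe) + Nat.card T.edgeSet : ℕ) : ℝ) := by exact_mod_cast h
  push_cast at this
  linarith

/-- A.a.s. `G(n,p)` contains a `(K,T)`-maximal copy of a strictly balanced graph `G` with
`ρ(G) < 1/α₂`, provided `f_{α₁}(K,T) < 0` and `n^{-α₂} ≤ p ≤ n^{-α₁}`. -/
theorem aas_maximal_copies {W U : Type*} [Fintype W] [Fintype U]
    (α₁ α₂ : ℝ) (h1 : 0 < α₁) (h12 : α₁ < α₂) (h2 : α₂ < 1)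
    (Gp : SimpleGraph W) (hSB : StrictlyBalanced Gp) (hρ : density Gp < 1 / α₂)
    (Kp : SimpleGraph U) (T : Kp.Subgraph) {t : ℕ} (s : Fin t → U)
    (hs : Function.Injective s) (hsrange : Set.range s = T.verts)
    (hT : T ≠ ⊤)
    (hfK : fAlpha α₁ (⊤ : Kp.Subgraph) T < 0)
    (p : ℕ → ℝ) (hp : ∀ n : ℕ, (n : ℝ) ^ (-α₂) ≤ p n ∧ p n ≤ (n : ℝ) ^ (-α₁)) :
    Tendsto (fun n : ℕ => probPred n (p n) (fun Γ =>
        ∃ f : W → Fin n, Function.Injective f ∧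
          (∀ u v : W, Gp.Adj u v → Γ.Adj (f u) (f v)) ∧
          GraphMaximal Kp T s Γ (Set.range f)))
      atTop (nhds 1) := by
  classical
  set v := Fintype.card W
  set K' := Kp \ T.spanningCoe with hK'
  set Tv := T.verts.toFinset with hTv
  set γ : ℝ := fAlpha α₁ (⊤ : Kp.Subgraph) T with hγ
  have hγ' : γ = ((Fintype.card U - Tv.card : ℕ) : ℝ) - α₁ * edgeCount K' := by
    rw [hγ, hK', edgeCount_sdiff, fAlpha, Nat.cast_sub (Finset.card_le_univ _)]
    congr 2
    · simp
    · rw [hTv, Set.toFinset_card, Nat.card_eq_fintype_card]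
  have hα₂ : 0 < α₂ := h1.trans h12
  have hpos : ∀ n : ℕ, 1 ≤ n → 0 < p n := fun n hn =>
    lt_of_lt_of_le (Real.rpow_pos_of_pos (by exact_mod_cast hn) _) (hp n).1
  have hle : ∀ n : ℕ, 1 ≤ n → p n ≤ 1 := fun n hn =>
    (hp n).2.trans (Real.rpow_le_one_of_one_le_of_nonpos (by exact_mod_cast hn) (by linarith))
  have hlim : Tendsto (fun n : ℕ => 1 - (2 * 2 ^ v * ((v : ℝ) ^ Tv.card * (n : ℝ) ^ γ) +
        4 * 4 ^ v * ∑ S ∈ (Finset.univ : Finset (Finset W)).filter (·.Nonempty),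
          (v : ℝ) ^ S.card * (n : ℝ) ^ (-((S.card : ℝ) - α₂ * eIn Gp S)))) atTop (nhds 1) := by
    have hz : ∀ y : ℝ, 0 < y → Tendsto (fun n : ℕ => (n : ℝ) ^ (-y)) atTop (nhds 0) :=
      fun y hy => (tendsto_rpow_neg_atTop hy).comp tendsto_natCast_atTop_atTop
    have t1 : Tendsto (fun n : ℕ => (n : ℝ) ^ γ) atTop (nhds 0) := by
      simpa using hz (-γ) (by linarith)
    have t2 : Tendsto (fun n : ℕ => ∑ S ∈ (Finset.univ : Finset (Finset W)).filter (·.Nonempty),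
          (v : ℝ) ^ S.card * (n : ℝ) ^ (-((S.card : ℝ) - α₂ * eIn Gp S))) atTop
          (nhds (∑ S ∈ (Finset.univ : Finset (Finset W)).filter (·.Nonempty),
            (v : ℝ) ^ S.card * 0)) :=
      tendsto_finsetSum _ fun S hS =>
        (hz _ (eIn_lt α₂ hα₂ Gp hSB hρ S (Finset.mem_filter.1 hS).2)).const_mul _
    have := (((t1.const_mul ((v : ℝ) ^ Tv.card)).const_mul (2 * 2 ^ v)).add
      (t2.const_mul (4 * 4 ^ v))).const_sub 1
    simpa using this
  refine tendsto_of_tendsto_of_tendsto_of_le_of_le' hlim tendsto_const_nhds ?_ ?_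
  · filter_upwards [eventually_ge_atTop (2 * v + 1)] with n hn
    have hn1 : 1 ≤ n := by omega
    have hn0 : (0 : ℝ) < n := by exact_mod_cast hn1
    refine le_trans ?_ (finite_bound Gp K' Tv n (p n) (hpos n hn1) (hle n hn1) (by omega) hn1 _ ?_)
    · have b1 : (n : ℝ) ^ (Fintype.card U - Tv.card) * p n ^ edgeCount K' ≤ (n : ℝ) ^ γ := by
        rw [hγ', Real.rpow_sub' hn0.le (by rw [← hγ']; exact hfK.ne), Real.rpow_natCast, div_eq_mul_inv,
          ← Real.rpow_neg hn0.le, ← neg_mul, Real.rpow_mul hn0.le, Real.rpow_natCast]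
        have := (hpos n hn1).le
        have := (hp n).2
        gcongr
      have b2 : ∀ S : Finset W, ((n : ℝ) ^ S.card * p n ^ eIn Gp S)⁻¹ ≤
          (n : ℝ) ^ (-((S.card : ℝ) - α₂ * eIn Gp S)) := by
        intro S
        rw [Real.rpow_neg hn0.le, sub_eq_add_neg, Real.rpow_add hn0, Real.rpow_natCast,
          ← neg_mul, Real.rpow_mul hn0.le, Real.rpow_natCast]
        have := (hp n).1
        have h3 : 0 < (n : ℝ) ^ (-α₂) := Real.rpow_pos_of_pos hn0 _
        gcongr
      have b3 : ∑ S ∈ (Finset.univ : Finset (Finset W)).filter (·.Nonempty),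
          (v : ℝ) ^ S.card * ((n : ℝ) ^ S.card * p n ^ eIn Gp S)⁻¹ ≤
          ∑ S ∈ (Finset.univ : Finset (Finset W)).filter (·.Nonempty),
          (v : ℝ) ^ S.card * (n : ℝ) ^ (-((S.card : ℝ) - α₂ * eIn Gp S)) :=
        Finset.sum_le_sum fun S _ => mul_le_mul_of_nonneg_left (b2 S) (by positivity)
      gcongr
    · intro Γ hΓ f hf
      have hnm : ¬ GraphMaximal Kp T s Γ (Set.range f) := by
        intro hm
        exact hΓ ⟨f, f.injective, fun u w huw =>
          hf ((SimpleGraph.map_adj _ _ _ _).2 ⟨u, w, huw, rfl, rfl⟩), hm⟩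
      unfold GraphMaximal at hnm
      push Not at hnm
      obtain ⟨tup, -, htA, g, ⟨hgi, hgs, hge⟩, hgA, -⟩ := hnm
      have hadj : ∀ a b, K'.Adj a b → Γ.Adj (g a) (g b) ∧ ¬(a ∈ T.verts ∧ b ∈ T.verts) := by
        intro a b hab
        rw [hK', SimpleGraph.sdiff_adj, SimpleGraph.Subgraph.spanningCoe_adj] at hab
        exact (hge a b).1 hab
      refine ⟨⟨g, hgi⟩, (mem_badPairs _ _ _ _).2 ⟨?_, ?_⟩, ?_⟩
      · intro u
        simp only [hTv, Set.mem_toFinset, Finset.mem_map, Finset.mem_univ, true_and,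
          Function.Embedding.coeFn_mk]
        constructor
        · intro hu
          rw [← hsrange] at hu
          obtain ⟨j, rfl⟩ := hu
          rw [hgs j]
          exact htA j
        · intro hu
          obtain ⟨j, hj⟩ := hgA u hu
          rw [← hgs j] at hj
          rw [← hgi hj, ← hsrange]
          exact ⟨j, rfl⟩
      · intro a b hab
        simpa [hTv] using (hadj a b hab).2
      · intro a b hab
        rw [SimpleGraph.map_adj] at hab
        obtain ⟨x, y, hxy, rfl, rfl⟩ := hab
        exact (hadj x y hxy).1
  · filter_upwards [eventually_ge_atTop 1] with n hn
    exact prob_upper n (p n) (hpos n hn).le (hle n hn) _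

end RandomGraphSpectra
end
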